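/- arXiv:1604.03788 — 2 statements merged into one kernel-verified Lean document; each statement's English description precedes it below -/
import Mathlib

section
/- Let P = ⟨x₁,…,x_m | r₁,…,rₙ⟩ be a finite presentation in which each relator rᵢ is a freely reduced and cyclically reduced word and the rᵢ are pairwise distinct, let k ≥ 12, and let P̄_t^k denote the group presented by P_t^k = ⟨x₁,…,x_m,t | (r₁t)^k,…,(rₙt)^k, t^k⟩. Then tor₁(P̄_t^k), the normal subgroup of P̄_t^k generated by its torsion elements, equals the normal closure in P̄_t^k of the images of the n+1 elements r₁t,…,rₙt and t. -/
/-- A word on an alphabet `β`: a list of letters with exponents `±1`. -/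
abbrev Word (β : Type*) := List (β × Bool)

/-- A word is freely reduced if it has no subword `x x⁻¹` or `x⁻¹ x`. -/
def Reduced {β : Type*} (w : Word β) : Prop :=
  w.Chain' fun a b => a.1 = b.1 → a.2 = b.2

/-- A word is cyclically reduced if it is freely reduced and its first letter is not the
inverse of its last letter. -/
def CyclicallyReduced {β : Type*} (w : Word β) : Prop :=
  Reduced w ∧ ∀ a ∈ w.getLast?, ∀ b ∈ w.head?, a.1 = b.1 → a.2 = b.2

/-- The element of the free group on `x₁,…,x_m,t` given by the word `rᵢ` on the `x`'s. -/
def rho {m n : ℕ} (r : Fin n → Word (Fin m)) (i : Fin n) : FreeGroup (Fin m ⊕ Unit) :=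
  FreeGroup.mk ((r i).map fun l => (Sum.inl l.1, l.2))

/-- The generator `t` of the free group on `x₁,…,x_m,t`. -/
def tGen (m : ℕ) : FreeGroup (Fin m ⊕ Unit) := FreeGroup.of (Sum.inr ())

/-- The relator set `{(r₁t)^k, …, (rₙt)^k, t^k}` of the presentation
`P_t^k = ⟨x₁,…,x_m,t | (r₁t)^k,…,(rₙt)^k, t^k⟩`. -/
def PtkRels (m n k : ℕ) (r : Fin n → Word (Fin m)) : Set (FreeGroup (Fin m ⊕ Unit)) :=
  (Set.range fun i => (rho r i * tGen m) ^ k) ∪ {tGen m ^ k}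

/-- The relator set `{r₁, …, rₙ}` of the presentation `P = ⟨x₁,…,x_m | r₁,…,rₙ⟩`. -/
def PRels (m n : ℕ) (r : Fin n → Word (Fin m)) : Set (FreeGroup (Fin m)) :=
  Set.range fun i => FreeGroup.mk (r i)

/-- `torOne G` is the normal subgroup of `G` generated by the torsion elements. -/
def torOne (G : Type*) [Group G] : Subgroup G :=
  Subgroup.normalClosure {g : G | IsOfFinOrder g}

open Monoid in
/-- The free product of two copies of `A`. -/
abbrev Dbl (A : Type) [Group A] : Type := CoprodI fun _ : Bool => A

namespace Dbl

open Monoid CoprodI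

variable {A : Type} [Group A]

/-- The product of the two copies of `w`. -/
def diag (w : A) : Dbl A := of (i := false) w * of (i := true) w

open scoped Classical in
lemma fstIdx_smul {i : Bool} {w : A} (hw : w ≠ 1) (W : CoprodI.Word fun _ : Bool => A)
    (hW : W.toList.head? ≠ some ⟨i, w⁻¹⟩) :
    (of (M := fun _ : Bool => A) (i := i) w • W).fstIdx = some i := by
  induction W using CoprodI.Word.consRecOn with
  | empty =>
    rw [← CoprodI.Word.cons_eq_smul (h1 := by simp [Word.fstIdx]) (h2 := hw)]
    simp
  | cons j m V h1 h2 _ =>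
    by_cases hj : j = i
    · subst hj
      have hm : w * m ≠ 1 := by
        intro h
        apply hW
        simp [eq_inv_of_mul_eq_one_right h]
      rw [CoprodI.Word.cons_eq_smul, smul_smul, ← map_mul,
        ← CoprodI.Word.cons_eq_smul (h1 := h1) (h2 := hm)]
      simp
    · rw [← CoprodI.Word.cons_eq_smul (h1 := by simpa using hj) (h2 := hw)]
      simp

open scoped Classical in
lemma head_smul_smul {i j : Bool} (hij : i ≠ j) {v w : A} (hv : v ≠ 1) (hw : w ≠ 1)
    (W : CoprodI.Word fun _ : Bool => A) (hW : W.toList.head? ≠ some ⟨i, w⁻¹⟩) :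
    (of (M := fun _ : Bool => A) (i := j) v •
      of (M := fun _ : Bool => A) (i := i) w • W).toList.head? = some ⟨j, v⟩ := by
  have h := fstIdx_smul hw W hW
  rw [← CoprodI.Word.cons_eq_smul (h1 := by simpa [h] using hij) (h2 := hv)]
  simp

open scoped Classical in
/-- The number of syllables of the normal form. -/
noncomputable def len (z : Dbl A) : ℕ := (CoprodI.Word.equiv z).toList.length

open scoped Classical in
lemma exists_len_lt (z : Dbl A) :
    ∃ i : Bool, ∀ m : A, m ≠ 1 → len z < len (of (M := fun _ : Bool => A) (i := i) m * z) := by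
  obtain ⟨i, hi⟩ : ∃ i : Bool, (CoprodI.Word.equiv z).fstIdx ≠ some i := by
    by_contra! h
    simpa using (h true).symm.trans (h false)
  refine ⟨i, fun m hm => ?_⟩
  have : CoprodI.Word.equiv (of (M := fun _ : Bool => A) (i := i) m * z) =
      CoprodI.Word.cons m (Word.equiv z) hi hm := by
    rw [CoprodI.Word.cons_eq_smul]
    simp [CoprodI.Word.equiv, mul_smul]
  simp [len, this]

theorem lift_diag_injective [IsMulTorsionFree A] :
    Function.Injective (FreeGroup.lift fun w : {w : A // w ≠ 1} => diag (w : A)) := by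
  classical
  rcases subsingleton_or_nontrivial {w : A // w ≠ 1} with hs | hn
  · have : IsEmpty {w : A // w ≠ 1} := by
      refine ⟨fun w => w.2 ?_⟩
      have h : (⟨w.1⁻¹, inv_ne_one.mpr w.2⟩ : {w : A // w ≠ 1}) = w := Subsingleton.elim _ _
      have h1 : (w : A)⁻¹ = w := congrArg Subtype.val h
      exact self_eq_inv.mp h1.symm
    exact Function.injective_of_subsingleton _
  · refine FreeGroup.injective_lift_of_ping_pong (α := CoprodI.Word fun _ : Bool => A) _
      (fun w => {W | W.toList.head? = some ⟨false, (w : A)⟩})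
      (fun w => {W | W.toList.head? = some ⟨true, (w : A)⁻¹⟩}) ?_ ?_ ?_ ?_ ?_ ?_
    · intro w
      exact ⟨CoprodI.Word.cons (M := fun _ : Bool => A) (i := false) (w : A) Word.empty
        (by simp [CoprodI.Word.fstIdx]) w.2, by simp⟩
    · intro v w hvw
      refine Set.disjoint_left.mpr fun W h1 h2 => hvw ?_
      have := h1.symm.trans h2
      simpa [Subtype.ext_iff] using this
    · intro v w hvw
      refine Set.disjoint_left.mpr fun W h1 h2 => hvw ?_
      have := h1.symm.trans h2
      simpa [Subtype.ext_iff] using this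
    · intro v w
      refine Set.disjoint_left.mpr fun W h1 h2 => ?_
      have := h1.symm.trans h2
      simp at this
    · intro w
      rintro _ ⟨W, hW, rfl⟩
      simpa [diag, mul_smul] using head_smul_smul (i := true) (j := false) (by simp) w.2 w.2 W hW
    · intro w
      rintro _ ⟨W, hW, rfl⟩
      have := head_smul_smul (i := false) (j := true) (by simp) (inv_ne_one.mpr w.2)
        (inv_ne_one.mpr w.2) W (by simpa using hW)
      simpa [diag, mul_smul] using this

lemma freeGroup_lift_inv_injective {ι H : Type} [Group H] {f : ι → H}
    (hf : Function.Injective (FreeGroup.lift f)) :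
    Function.Injective (FreeGroup.lift fun i => (f i)⁻¹) := by
  have h1 : (FreeGroup.lift fun i => (f i)⁻¹) =
      (FreeGroup.lift f).comp (FreeGroup.lift fun i => (FreeGroup.of i)⁻¹) := by
    ext i; simp
  have h2 : Function.Involutive (FreeGroup.lift fun i : ι => (FreeGroup.of i)⁻¹) := by
    intro x
    rw [← MonoidHom.comp_apply]
    conv_rhs => rw [← MonoidHom.id_apply (FreeGroup ι) x]
    congr 1
    ext i; simp
  rw [h1]
  exact hf.comp h2.injective

/-- There is a group with four homomorphisms from `A` whose pointwise product is trivial, the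
first two of which generate the free product of their images. -/
theorem exists_four_homs [IsMulTorsionFree A] :
    ∃ (K : Type) (_ : Group K) (φ : Dbl A →* K) (ψ : Dbl A →* K), Function.Injective φ ∧
      ∀ w : A, φ (diag w) * ψ (diag w) = 1 := by
  let f : ∀ b : Bool, FreeGroup {w : A // w ≠ 1} →* Dbl A := fun b =>
    FreeGroup.lift fun w => if b then diag (w : A) else (diag (w : A))⁻¹
  have hf : ∀ b, Function.Injective (f b) := by
    rintro (_ | _)
    · simpa [f] using freeGroup_lift_inv_injective (lift_diag_injective (A := A))
    · simpa [f] using lift_diag_injective (A := A)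
  refine ⟨PushoutI f, inferInstance, PushoutI.of (φ := f) true, PushoutI.of (φ := f) false,
    PushoutI.of_injective hf true, fun w => ?_⟩
  by_cases hw : w = 1
  · simp [hw, diag]
  · have h1 := PushoutI.of_apply_eq_base f true (FreeGroup.of ⟨w, hw⟩)
    have h2 := PushoutI.of_apply_eq_base f false (FreeGroup.of ⟨w, hw⟩)
    rw [← h2] at h1
    simp only [f, FreeGroup.lift_apply_of, if_true] at h1
    rw [h1]
    simp

end Dbl

/-- `G` is presented, relative to `A`, by one generator `t` and the relators `(w t)^k` for
`w ∈ S`. -/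
structure IsRelPres {A G : Type} [Group A] [Group G] (α : A →* G) (t : G) (S : Finset A)
    (k : ℕ) : Prop where
  rel : ∀ w ∈ S, (α w * t) ^ k = 1
  univ : ∀ (H : Type) [Group H] (β : A →* H) (s : H), (∀ w ∈ S, (β w * s) ^ k = 1) →
    ∃ Φ : G →* H, (∀ a, Φ (α a) = β a) ∧ Φ t = s
  gen : ∀ H : Subgroup G, (∀ a, α a ∈ H) → t ∈ H → H = ⊤

namespace IsRelPres

section Cyclic

/-- The cyclic shift of the layers of `K × ZMod k`. -/
def layerShift {K : Type} {k : ℕ} : Equiv.Perm (K × ZMod k) :=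
  (Equiv.refl K).prodCongr (Equiv.subRight 1)

lemma layerShift_apply {K : Type} {k : ℕ} (p : K × ZMod k) :
    layerShift p = (p.1, p.2 - 1) := rfl

variable {A K : Type} [Group A] [Group K] {k : ℕ}

/-- Layer `j` of `K × ZMod k` is acted on by `A` through the `j`-th homomorphism. -/
def layerHom (c : ℕ → A →* K) : A →* Equiv.Perm (K × ZMod k) :=
  MonoidHom.toHomPerm
    { toFun := fun a p => (c p.2.val a * p.1, p.2)
      map_one' := by funext p; simp; rfl
      map_mul' := fun a b => by
        funext p
        simp only [map_mul, mul_assoc]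
        rfl }

lemma layerHom_apply (c : ℕ → A →* K) (a : A) (p : K × ZMod k) :
    layerHom c a p = (c p.2.val a * p.1, p.2) := rfl

lemma layer_pow_eq_one (hk : 4 ≤ k) (c : ℕ → A →* K) (hc : ∀ n, 4 ≤ n → c n = 1) (w : A)
    (hw : c 0 w * c 1 w * (c 2 w * c 3 w) = 1) :
    (layerHom c w * layerShift (K := K) (k := k)) ^ k = 1 := by
  have : NeZero k := ⟨by omega⟩
  set σ : Equiv.Perm (K × ZMod k) := layerHom c w * layerShift with hσ
  have step : ∀ p, σ p = (c (p.2 - 1).val w * p.1, p.2 - 1) := fun p => rfl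
  have down : ∀ (n : ℕ) (x : K), n < k →
      (σ ^ (n + 1)) (x, ((n + 1 : ℕ) : ZMod k)) = (σ ^ n) (c n w * x, (n : ZMod k)) := by
    intro n x hn
    rw [pow_succ, Equiv.Perm.mul_apply, step]
    simp [ZMod.val_natCast_of_lt hn]
  have full : ∀ n, 4 ≤ n → n ≤ k → ∀ x : K, (σ ^ n) (x, (n : ZMod k)) = (x, 0) := by
    intro n hn
    induction n, hn using Nat.le_induction with
    | base =>
      intro _ x
      rw [down 3 x (by omega), down 2 _ (by omega), down 1 _ (by omega), down 0 _ (by omega)]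
      simp only [pow_zero, Equiv.Perm.one_apply, Nat.cast_zero, Prod.mk.injEq, and_true]
      rw [← mul_assoc, ← mul_assoc, ← mul_assoc, mul_assoc (c 0 w * c 1 w), hw, one_mul]
    | succ n hn ih =>
      intro hnk x
      rw [down n x (by omega), hc n hn]
      simpa using ih (by omega) x
  have base : ∀ x : K, (σ ^ k) (x, 0) = (x, 0) := fun x => by
    simpa using full k hk le_rfl x
  have snd : ∀ (i : ℕ) (p : K × ZMod k), ((σ ^ i) p).2 = p.2 - i := by
    intro i
    induction i with
    | zero => simp
    | succ i ih =>
      intro p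
      rw [pow_succ, Equiv.Perm.mul_apply, ih, step]
      push_cast
      ring
  ext1 p
  apply (σ ^ p.2.val).injective
  have h0 : (σ ^ p.2.val) p = (((σ ^ p.2.val) p).1, 0) :=
    Prod.ext rfl (by rw [snd]; simp)
  rw [← Equiv.Perm.mul_apply, ← pow_add, add_comm, pow_add, Equiv.Perm.mul_apply, h0, base,
    ← h0, Equiv.Perm.one_apply]

end Cyclic

variable {A G : Type} [Group A] [Group G] {α : A →* G} {t : G} {S : Finset A} {k : ℕ}

open Monoid

/-- The homomorphism sending the two copies of `A` to `A` and `t A t⁻¹`. -/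
def theta (α : A →* G) (t : G) : Dbl A →* G :=
  CoprodI.lift fun b => if b then (MulAut.conj t).toMonoidHom.comp α else α

@[simp] lemma theta_false (a : A) : theta α t (CoprodI.of (i := false) a) = α a := by
  simp [theta]

@[simp] lemma theta_true (a : A) :
    theta α t (CoprodI.of (i := true) a) = t * α a * t⁻¹ := by
  simp [theta]

theorem theta_injective [IsMulTorsionFree A] (hG : IsRelPres α t S k) (hk : 4 ≤ k) :
    Function.Injective (theta α t) := by
  have : NeZero k := ⟨by omega⟩
  have : Fact (1 < k) := ⟨by omega⟩
  obtain ⟨K, _, φ, ψ, hφ, hφψ⟩ := Dbl.exists_four_homs (A := A)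
  let c : ℕ → A →* K := fun n =>
    match n with
    | 0 => φ.comp (CoprodI.of (M := fun _ : Bool => A) (i := false))
    | 1 => φ.comp (CoprodI.of (M := fun _ : Bool => A) (i := true))
    | 2 => ψ.comp (CoprodI.of (M := fun _ : Bool => A) (i := false))
    | 3 => ψ.comp (CoprodI.of (M := fun _ : Bool => A) (i := true))
    | _ => 1
  have hc : ∀ n, 4 ≤ n → c n = 1 := by
    intro n hn
    obtain ⟨m, rfl⟩ := Nat.exists_eq_add_of_le hn
    simp [c, add_comm 4 m]
  obtain ⟨Φ, hΦα, hΦt⟩ := hG.univ (Equiv.Perm (K × ZMod k)) (layerHom c) layerShift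
    fun w _ => layer_pow_eq_one hk c hc w (by simpa [Dbl.diag, c] using hφψ w)
  have key : ∀ (y : Dbl A) (x : K), Φ (theta α t y) (x, 0) = (φ y * x, 0) := by
    intro y
    induction y using CoprodI.induction_on with
    | one => simp
    | of i a =>
      intro x
      cases i
      · simp [hΦα, layerHom_apply, c]
      · have h : (layerShift (K := K) (k := k)).symm (x, 0) = (x, 1) := by
          rw [Equiv.symm_apply_eq, layerShift_apply]
          simp
        simp [hΦα, hΦt, layerHom_apply, layerShift_apply, c, h, ZMod.val_one]
    | mul y z hy hz =>
      intro x
      rw [map_mul, map_mul, Equiv.Perm.mul_apply, hz, hy, map_mul, mul_assoc]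
  intro y z hyz
  apply hφ
  have h := key y 1
  rw [hyz, key z 1] at h
  simpa using (congrArg Prod.fst h).symm

lemma alpha_injective [IsMulTorsionFree A] (hG : IsRelPres α t S k) (hk : 4 ≤ k) :
    Function.Injective α := by
  intro a b h
  have : theta α t (CoprodI.of (i := false) a) = theta α t (CoprodI.of (i := false) b) := by
    simpa using h
  exact CoprodI.of_injective (M := fun _ : Bool => A) false (hG.theta_injective hk this)

/-- The exponent sum of `t` modulo `k`. -/
lemma exists_exponent (hG : IsRelPres α t S k) :
    ∃ χ : G →* Multiplicative (ZMod k), (∀ a, χ (α a) = 1) ∧ χ t = Multiplicative.ofAdd 1 := by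
  refine hG.univ _ 1 _ fun w _ => ?_
  rw [MonoidHom.one_apply, one_mul, ← ofAdd_nsmul]
  simp

lemma exponent_theta {χ : G →* Multiplicative (ZMod k)} (hχ : ∀ a, χ (α a) = 1) (y : Dbl A) :
    χ (theta α t y) = 1 := by
  induction y using CoprodI.induction_on with
  | one => simp
  | of i a => cases i <;> simp [hχ]
  | mul y z hy hz => simp [hy, hz]

lemma exponent_pow {χ : G →* Multiplicative (ZMod k)} (hχ : ∀ a, χ (α a) = 1)
    (hχt : χ t = Multiplicative.ofAdd 1) (w : A) (i : ℤ) :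
    χ ((α w * t) ^ i) = Multiplicative.ofAdd (i : ZMod k) := by
  rw [map_zpow, map_mul, hχ, hχt, one_mul, ← ofAdd_zsmul]
  simp

lemma zpow_eq_one_iff (hG : IsRelPres α t S k) {w : A} (hw : w ∈ S)
    {χ : G →* Multiplicative (ZMod k)}
    (hχ : ∀ a, χ (α a) = 1) (hχt : χ t = Multiplicative.ofAdd 1) {i : ℤ} :
    (α w * t) ^ i = 1 ↔ χ ((α w * t) ^ i) = 1 := by
  refine ⟨fun h => by rw [h, map_one], fun h => ?_⟩
  rw [exponent_pow hχ hχt, ofAdd_eq_one, ZMod.intCast_zmod_eq_zero_iff_dvd] at h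
  obtain ⟨j, rfl⟩ := h
  rw [zpow_mul, zpow_natCast, hG.rel w hw, one_zpow]

end IsRelPres

namespace PermModule

attribute [local instance] Finsupp.comapDistribMulAction

open Finset

variable {G : Type} [Group G]

section Norm

variable {M N : Type} [AddCommGroup M] [DistribMulAction G M] [AddCommGroup N]
  [DistribMulAction G N]

/-- The norm element `1 + h + ⋯ + h^(p-1)` acting on `x`. -/
def cyclicNorm (h : G) (p : ℕ) (x : M) : M := ∑ i ∈ range p, h ^ i • x

lemma cyclicNorm_sub (h : G) (p : ℕ) (x y : M) :
    cyclicNorm h p (x - y) = cyclicNorm h p x - cyclicNorm h p y := by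
  simp [cyclicNorm, smul_sub]

lemma cyclicNorm_add (h : G) (p : ℕ) (x y : M) :
    cyclicNorm h p (x + y) = cyclicNorm h p x + cyclicNorm h p y := by
  simp [cyclicNorm, sum_add_distrib]

lemma cyclicNorm_zsmul (h : G) (p : ℕ) (a : ℤ) (x : M) :
    cyclicNorm h p (a • x) = a • cyclicNorm h p x := by
  simp only [cyclicNorm, smul_sum]
  exact sum_congr rfl fun i _ => smul_comm _ _ _

lemma cyclicNorm_smul {h : G} {p : ℕ} (hp : h ^ p = 1) (x : M) :
    cyclicNorm h p (h • x) = cyclicNorm h p x := by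
  have h1 := sum_range_succ (fun i => h ^ i • x) p
  rw [sum_range_succ'] at h1
  simpa [cyclicNorm, smul_smul, ← pow_succ, hp] using h1

lemma smul_cyclicNorm {h : G} {p : ℕ} (hp : h ^ p = 1) (x : M) :
    h • cyclicNorm h p x = cyclicNorm h p x := by
  conv_rhs => rw [← cyclicNorm_smul hp x]
  simp only [cyclicNorm, smul_sum, smul_smul, ← pow_succ, ← pow_succ']

lemma cyclicNorm_sub_smul {h : G} {p : ℕ} (hp : h ^ p = 1) (x : M) :
    cyclicNorm h p (x - h • x) = 0 := by
  rw [cyclicNorm_sub, cyclicNorm_smul hp, sub_self]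

lemma map_cyclicNorm {f : M →+ N} (hf : ∀ (g : G) x, f (g • x) = g • f x) (h : G) (p : ℕ)
    (x : M) : f (cyclicNorm h p x) = cyclicNorm h p (f x) := by
  simp [cyclicNorm, hf]

end Norm

variable {X : Type} [MulAction G X]

lemma pow_smul_injOn {h : G} {p : ℕ} (hp : p.Prime) (hhp : h ^ p = 1) {x : X} (hx : h • x ≠ x)
    {i j : ℕ} (hi : i < p) (hj : j < p) (hij : h ^ i • x = h ^ j • x) : i = j := by
  have hper : MulAction.period h x = p := by
    have h1 : MulAction.period h x ∣ p := by
      rw [← MulAction.pow_smul_eq_iff_period_dvd, hhp, one_smul]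
    rcases (Nat.dvd_prime hp).mp h1 with h2 | h2
    · exact absurd (by simpa using MulAction.pow_smul_eq_iff_period_dvd.mpr h2.dvd) hx
    · exact h2
  wlog hle : i ≤ j generalizing i j
  · exact (this hj hi hij.symm (by omega)).symm
  obtain ⟨d, rfl⟩ := Nat.exists_eq_add_of_le hle
  rw [pow_add, mul_smul, smul_left_cancel_iff, eq_comm, MulAction.pow_smul_eq_iff_period_dvd,
    hper] at hij
  have := Nat.eq_zero_of_dvd_of_lt hij (by omega)
  omega

/-- A choice of a representative in each orbit of the cyclic group generated by `h`. -/
lemma exists_orbit_rep {h : G} {p : ℕ} (hp0 : 0 < p) (hhp : h ^ p = 1) :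
    ∃ rep : X → X, (∀ x, rep (h • x) = rep x) ∧ ∀ x, ∃ i < p, h ^ i • rep x = x := by
  let s := MulAction.orbitRel (Subgroup.zpowers h) X
  refine ⟨fun x => (Quotient.mk s x).out, ?_, ?_⟩
  · intro x
    have h1 : Quotient.mk s (h • x) = Quotient.mk s x :=
      Quotient.sound ⟨⟨h, Subgroup.mem_zpowers h⟩, rfl⟩
    simp only [h1]
  · intro x
    obtain ⟨⟨g, hg⟩, hgx⟩ := s.symm (Quotient.mk_out (s := s) x)
    have hfin : IsOfFinOrder h := isOfFinOrder_iff_pow_eq_one.mpr ⟨p, hp0, hhp⟩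
    obtain ⟨n, rfl⟩ := hfin.mem_powers_iff_mem_zpowers.mpr hg
    exact ⟨n % p, Nat.mod_lt _ hp0, by rw [← pow_eq_pow_mod n hhp]; exact hgx⟩

lemma exists_eq_cyclicNorm {h : G} {p : ℕ} (hp : p.Prime) (hhp : h ^ p = 1)
    (hX : ∀ x : X, h • x ≠ x)
    {f : X →₀ ℤ} (hf : h • f = f) : ∃ f' : X →₀ ℤ, f = cyclicNorm h p f' := by
  classical
  obtain ⟨rep, hrep, hex⟩ := exists_orbit_rep (X := X) hp.pos hhp
  have hpow : ∀ (i : ℕ) (x : X), rep (h ^ i • x) = rep x := by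
    intro i
    induction i with
    | zero => simp
    | succ i ih => intro x; rw [pow_succ', mul_smul, hrep, ih]
  have hfpow : ∀ (i : ℕ) (x : X), f (h ^ i • x) = f x := by
    have h1 : ∀ x, f (h • x) = f x := fun x => by
      conv_lhs => rw [← hf]
      simp
    intro i
    induction i with
    | zero => simp
    | succ i ih => intro x; rw [pow_succ', mul_smul, h1, ih]
  have hreprep : ∀ x, rep (rep x) = rep x := fun x => by
    obtain ⟨i, _, hi⟩ := hex x
    conv_rhs => rw [← hi, hpow]
  refine ⟨f.filter fun x => rep x = x, ?_⟩
  ext x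
  obtain ⟨i, hip, hi⟩ := hex x
  have hi' : (h ^ i)⁻¹ • x = rep x := by rw [inv_smul_eq_iff, hi]
  rw [cyclicNorm, Finsupp.finsetSum_apply, Finset.sum_eq_single i]
  · rw [Finsupp.comapSMul_apply, hi',
      Finsupp.filter_apply_pos (fun x => rep x = x) _ (hreprep x)]
    conv_lhs => rw [← hi, hfpow]
  · intro j hj hji
    rw [Finsupp.comapSMul_apply, Finsupp.filter_apply_neg]
    intro hr
    apply hji
    have h2 : rep ((h ^ j)⁻¹ • x) = rep x := by
      conv_rhs => rw [← smul_inv_smul (h ^ j) x, hpow]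
    rw [h2, eq_inv_smul_iff] at hr
    exact pow_smul_injOn hp hhp (hX (rep x)) (Finset.mem_range.mp hj) hip (hr.trans hi.symm)
  · intro hj
    exact absurd (Finset.mem_range.mpr hip) hj

lemma exists_eq_sub {h : G} {p : ℕ} (hp : 0 < p) (hhp : h ^ p = 1)
    {f : X →₀ ℤ} (hf : cyclicNorm h p f = 0) : ∃ f' : X →₀ ℤ, f = f' - h • f' := by
  obtain ⟨rep, hrep, hex⟩ := exists_orbit_rep (X := X) hp hhp
  have hmap : ∀ (i : ℕ) (f : X →₀ ℤ), (h ^ i • f).mapDomain rep = f.mapDomain rep := by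
    intro i f
    rw [Finsupp.comapSMul_def, ← Finsupp.mapDomain_comp]
    congr 1
    funext x
    simp only [Function.comp_apply]
    induction i with
    | zero => simp
    | succ i ih => rw [pow_succ', mul_smul, hrep, ih]
  have hzero : f.mapDomain rep = 0 := by
    have h1 : (cyclicNorm h p f).mapDomain rep = p • f.mapDomain rep := by
      rw [cyclicNorm, ← Finsupp.mapDomain.addMonoidHom_apply, map_sum]
      simp [Finsupp.mapDomain.addMonoidHom, hmap]
    rw [hf, Finsupp.mapDomain_zero] at h1
    exact (smul_eq_zero.mp h1.symm).resolve_left hp.ne'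
  suffices H : ∀ f : X →₀ ℤ, ∃ f' : X →₀ ℤ, f - f.mapDomain rep = f' - h • f' by
    simpa [hzero] using H f
  intro f
  induction f using Finsupp.induction_linear with
  | zero => exact ⟨0, by simp⟩
  | add f g hf hg =>
    obtain ⟨f', hf'⟩ := hf
    obtain ⟨g', hg'⟩ := hg
    exact ⟨f' + g', by rw [Finsupp.mapDomain_add, add_sub_add_comm, hf', hg', smul_add]; abel⟩
  | single x z =>
    obtain ⟨i, _, hi⟩ := hex x
    refine ⟨-∑ j ∈ range i, h ^ j • Finsupp.single (rep x) z, ?_⟩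
    have h2 := Finset.sum_range_sub (fun j => h ^ j • Finsupp.single (rep x) z) i
    rw [Finset.sum_sub_distrib] at h2
    simp only [pow_succ', mul_smul, ← smul_sum, pow_zero, one_smul] at h2
    rw [smul_neg, Finsupp.mapDomain_single, neg_sub_neg, h2, Finsupp.comapSMul_single, hi]

end PermModule

namespace IsRelPres

attribute [local instance] Finsupp.comapDistribMulAction

open Finset

variable {A G : Type} [Group A] [Group G] {α : A →* G} {t : G} {S : Finset A} {k : ℕ}

/-- The faces of the relative Cayley complex. -/
abbrev Face (α : A →* G) (t : G) (S : Finset A) : Type :=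
  Σ w : {w : A // w ∈ S}, G ⧸ Subgroup.zpowers (α w * t)

/-- The boundary map from edges to vertices: the edge `g` joins `gA` to `gtA`. -/
noncomputable def bd₁ (α : A →* G) (t : G) : (G →₀ ℤ) →+ (G ⧸ α.range →₀ ℤ) :=
  Finsupp.mapDomain.addMonoidHom (fun g : G => ((g * t : G) : G ⧸ α.range)) -
    Finsupp.mapDomain.addMonoidHom (fun g : G => (g : G ⧸ α.range))

/-- The augmentation of a permutation module. -/
noncomputable def aug (X : Type) : (X →₀ ℤ) →+ ℤ := Finsupp.liftAddHom fun _ => AddMonoidHom.id ℤ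

/-- The boundary cycle of the face of type `w` based at `u`. -/
noncomputable def faceCycle (α : A →* G) (t : G) (k : ℕ) (w : A) (u : G) : G →₀ ℤ :=
  ∑ i ∈ range k, Finsupp.single (u * (α w * t) ^ i * α w) 1

/-- The boundary map from faces to edges. -/
noncomputable def bd₂ (α : A →* G) (t : G) (S : Finset A) (k : ℕ) :
    (Face α t S →₀ ℤ) →+ (G →₀ ℤ) :=
  (Finsupp.linearCombination ℤ fun σ : Face α t S =>
    faceCycle α t k σ.1 σ.2.out).toAddMonoidHom

lemma bd₁_single (g : G) (z : ℤ) : bd₁ α t (Finsupp.single g z) =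
    Finsupp.single ((g * t : G) : G ⧸ α.range) z - Finsupp.single (g : G ⧸ α.range) z := by
  simp [bd₁, Finsupp.mapDomain.addMonoidHom]

@[simp] lemma aug_single {X : Type} (x : X) (z : ℤ) : aug X (Finsupp.single x z) = z := by
  simp [aug]

lemma bd₁_smul (g : G) (x : G →₀ ℤ) : bd₁ α t (g • x) = g • bd₁ α t x := by
  induction x using Finsupp.induction_linear with
  | zero => simp
  | add f g hf hg => simp only [smul_add, map_add, hf, hg]
  | single x z =>
    rw [bd₁_single, smul_sub, Finsupp.comapSMul_single, Finsupp.comapSMul_single,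
      Finsupp.comapSMul_single, bd₁_single]
    simp [mul_assoc]

lemma aug_smul {X : Type} [MulAction G X] (g : G) (x : X →₀ ℤ) : aug X (g • x) = aug X x := by
  induction x using Finsupp.induction_linear with
  | zero => simp
  | add f g hf hg => simp only [smul_add, map_add, hf, hg]
  | single x z => simp

lemma aug_bd₁ (x : G →₀ ℤ) : aug _ (bd₁ α t x) = 0 := by
  induction x using Finsupp.induction_linear with
  | zero => simp
  | add f g hf hg => simp [hf, hg]
  | single x z => simp [bd₁_single]

lemma smul_faceCycle (g : G) (w : A) (u : G) :
    g • faceCycle α t k w u = faceCycle α t k w (g * u) := by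
  simp [faceCycle, smul_sum, mul_assoc]

lemma faceCycle_mul (hG : IsRelPres α t S k) {w : A} (hw : w ∈ S) (u : G) :
    faceCycle α t k w (u * (α w * t)) = faceCycle α t k w u := by
  have h1 := sum_range_succ
    (fun i => (Finsupp.single (u * (α w * t) ^ i * α w) 1 : G →₀ ℤ)) k
  rw [sum_range_succ', hG.rel w hw, pow_zero] at h1
  have h2 := add_right_cancel h1
  simpa [faceCycle, pow_succ', mul_assoc] using h2

lemma faceCycle_mul_zpow (hG : IsRelPres α t S k) {w : A} (hw : w ∈ S) (u : G) (j : ℤ) :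
    faceCycle α t k w (u * (α w * t) ^ j) = faceCycle α t k w u := by
  induction j using Int.induction_on with
  | zero => simp
  | succ i ih => rw [zpow_add_one, ← mul_assoc, hG.faceCycle_mul hw, ih]
  | pred i ih =>
    rw [← hG.faceCycle_mul hw, mul_assoc, zpow_sub_one, inv_mul_cancel_right, ih]

lemma faceCycle_eq_of_mk_eq (hG : IsRelPres α t S k) {w : A} (hw : w ∈ S) {u v : G}
    (huv : (u : G ⧸ Subgroup.zpowers (α w * t)) = v) :
    faceCycle α t k w u = faceCycle α t k w v := by
  obtain ⟨j, hj⟩ := QuotientGroup.eq.mp huv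
  have : v = u * (α w * t) ^ j := by
    simp only at hj
    rw [hj, mul_inv_cancel_left]
  rw [this, hG.faceCycle_mul_zpow hw]

lemma bd₂_single (hG : IsRelPres α t S k) (w : {w : A // w ∈ S}) (u : G) (z : ℤ) :
    bd₂ α t S k (Finsupp.single ⟨w, (u : G ⧸ Subgroup.zpowers (α w * t))⟩ z) =
      z • faceCycle α t k w u := by
  simp only [bd₂, LinearMap.toAddMonoidHom_coe, Finsupp.linearCombination_single]
  congr 1
  exact hG.faceCycle_eq_of_mk_eq w.2 (Quotient.out_eq' _)

lemma bd₂_smul (hG : IsRelPres α t S k) (g : G) (x : Face α t S →₀ ℤ) :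
    bd₂ α t S k (g • x) = g • bd₂ α t S k x := by
  induction x using Finsupp.induction_linear with
  | zero => simp
  | add f g hf hg => simp only [smul_add, map_add, hf, hg]
  | single x z =>
    obtain ⟨w, q⟩ := x
    obtain ⟨u, rfl⟩ := QuotientGroup.mk_surjective q
    rw [hG.bd₂_single, Finsupp.comapSMul_single]
    have : g • (⟨w, (u : G ⧸ Subgroup.zpowers (α w * t))⟩ : Face α t S) =
      ⟨w, ((g * u : G) : G ⧸ Subgroup.zpowers (α w * t))⟩ := rfl
    rw [this, hG.bd₂_single, smul_comm, smul_faceCycle]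

lemma bd₁_faceCycle (hG : IsRelPres α t S k) {w : A} (hw : w ∈ S) (u : G) :
    bd₁ α t (faceCycle α t k w u) = 0 := by
  have h1 : ∀ i, ((u * (α w * t) ^ i * α w : G) : G ⧸ α.range) = (u * (α w * t) ^ i : G) :=
    fun i => by
      rw [QuotientGroup.eq]
      exact ⟨w⁻¹, by rw [map_inv]; group⟩
  have h2 : ∀ i, u * (α w * t) ^ i * α w * t = u * (α w * t) ^ (i + 1) := fun i => by
    rw [pow_succ]; group
  rw [faceCycle, map_sum]
  simp only [bd₁_single, h1, h2]
  rw [Finset.sum_range_sub (fun i =>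
    (Finsupp.single ((u * (α w * t) ^ i : G) : G ⧸ α.range) 1 : G ⧸ α.range →₀ ℤ)),
    hG.rel w hw, pow_zero, sub_self]

lemma bd₁_bd₂ (hG : IsRelPres α t S k) (x : Face α t S →₀ ℤ) :
    bd₁ α t (bd₂ α t S k x) = 0 := by
  induction x using Finsupp.induction_linear with
  | zero => simp
  | add f g hf hg => simp [hf, hg]
  | single x z =>
    obtain ⟨w, q⟩ := x
    obtain ⟨u, rfl⟩ := QuotientGroup.mk_surjective q
    rw [hG.bd₂_single, map_zsmul, hG.bd₁_faceCycle w.2, smul_zero]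

/-- Connectedness of the relative Cayley complex. -/
theorem exists_bd₁_eq (hG : IsRelPres α t S k) {v : G ⧸ α.range →₀ ℤ} (hv : aug _ v = 0) :
    ∃ e, bd₁ α t e = v := by
  let H : Subgroup G :=
    { carrier := {u | ∃ e, bd₁ α t e =
        Finsupp.single (u : G ⧸ α.range) 1 - Finsupp.single ((1 : G) : G ⧸ α.range) 1}
      one_mem' := ⟨0, by simp⟩
      mul_mem' := by
        rintro a b ⟨e, he⟩ ⟨f, hf⟩
        refine ⟨a • f + e, ?_⟩
        rw [map_add, bd₁_smul, he, hf, smul_sub, Finsupp.comapSMul_single,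
          Finsupp.comapSMul_single, MulAction.Quotient.smul_coe, MulAction.Quotient.smul_coe]
        simp
      inv_mem' := by
        rintro a ⟨e, he⟩
        refine ⟨-(a⁻¹ • e), ?_⟩
        rw [map_neg, bd₁_smul, he, smul_sub, Finsupp.comapSMul_single,
          Finsupp.comapSMul_single, MulAction.Quotient.smul_coe, MulAction.Quotient.smul_coe]
        simp }
  have hH : H = ⊤ := by
    refine hG.gen H (fun a => ⟨0, ?_⟩) ⟨Finsupp.single 1 1, ?_⟩
    · have : ((α a : G) : G ⧸ α.range) = (1 : G) := by
        rw [QuotientGroup.eq]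
        exact ⟨a⁻¹, by simp⟩
      simp [this]
    · simp [bd₁_single]
  suffices h : ∀ v : G ⧸ α.range →₀ ℤ, ∃ e, bd₁ α t e =
      v - aug _ v • Finsupp.single ((1 : G) : G ⧸ α.range) 1 by
    simpa [hv] using h v
  intro v
  induction v using Finsupp.induction_linear with
  | zero => exact ⟨0, by simp⟩
  | add f g hf hg =>
    obtain ⟨e, he⟩ := hf
    obtain ⟨e', he'⟩ := hg
    exact ⟨e + e', by rw [map_add, map_add, he, he', add_smul]; abel⟩
  | single q z =>
    obtain ⟨u, rfl⟩ := QuotientGroup.mk_surjective q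
    obtain ⟨e, he⟩ : u ∈ H := hH ▸ Subgroup.mem_top u
    exact ⟨z • e, by rw [map_zsmul, he, smul_sub]; simp⟩

/-- The action of `G` on the quotient by an invariant subgroup. -/
@[reducible]
def quotientAction {M : Type} [AddCommGroup M] [DistribMulAction G M] (N : AddSubgroup M)
    (hN : ∀ (g : G), ∀ x ∈ N, g • x ∈ N) : DistribMulAction G (M ⧸ N) where
  smul g := QuotientAddGroup.map N N (DistribSMul.toAddMonoidHom M g) (hN g)
  one_smul x := by
    obtain ⟨x, rfl⟩ := QuotientAddGroup.mk_surjective x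
    exact congrArg _ (one_smul G x)
  mul_smul g h x := by
    obtain ⟨x, rfl⟩ := QuotientAddGroup.mk_surjective x
    exact congrArg _ (mul_smul g h x)
  smul_zero g :=
    map_zero (QuotientAddGroup.map N N (DistribSMul.toAddMonoidHom M g) (hN g))
  smul_add g :=
    map_add (QuotientAddGroup.map N N (DistribSMul.toAddMonoidHom M g) (hN g))

/-- A relative presentation gives derivations. -/
lemma exists_derivation (hG : IsRelPres α t S k) {M : Type} [AddCommGroup M]
    [DistribMulAction G M] (m : M)
    (hm : ∀ w ∈ S, ∑ i ∈ range k, ((α w * t) ^ i * α w) • m = 0) :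
    ∃ d : G → M, (∀ g a, d (g * α a) = d g) ∧ ∀ g, d (g * t) = d g + g • m := by
  let s : Equiv.Perm M := (MulAction.toPerm t).trans (Equiv.addLeft m)
  have hs : ∀ x, s x = m + t • x := fun x => rfl
  let β : A →* Equiv.Perm M := (MulAction.toPermHom G M).comp α
  have hβ : ∀ a x, β a x = α a • x := fun a x => rfl
  obtain ⟨Φ, hΦα, hΦt⟩ := hG.univ (Equiv.Perm M) β s fun w hw => by
    have hpow : ∀ (n : ℕ) (x : M), ((β w * s) ^ n) x =
        ∑ i ∈ range n, ((α w * t) ^ i * α w) • m + (α w * t) ^ n • x := by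
      intro n
      induction n with
      | zero => simp
      | succ n ih =>
        intro x
        rw [pow_succ, Equiv.Perm.mul_apply, ih, Equiv.Perm.mul_apply, hβ, hs, sum_range_succ,
          smul_add, smul_add, smul_smul, smul_smul, smul_smul, pow_succ, add_assoc,
          mul_assoc _ (α w) t]
    ext x
    rw [hpow, hm w hw, hG.rel w hw]
    simp
  let H : Subgroup G :=
    { carrier := {u | ∀ x, Φ u x = Φ u 0 + u • x}
      one_mem' := by simp
      mul_mem' := by
        intro a b ha hb x
        rw [map_mul, Equiv.Perm.mul_apply, Equiv.Perm.mul_apply, ha, hb, ha (Φ b 0), smul_add,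
          mul_smul, add_assoc]
      inv_mem' := by
        intro a ha x
        apply (Φ a).injective
        rw [ha (Φ a⁻¹ 0 + a⁻¹ • x), smul_add, smul_inv_smul, ← add_assoc, ← ha,
          ← Equiv.Perm.mul_apply, ← Equiv.Perm.mul_apply, ← map_mul]
        simp }
  have hH : H = ⊤ := by
    refine hG.gen H (fun a x => ?_) fun x => ?_
    · rw [hΦα, hβ, hβ, smul_zero, zero_add]
    · rw [hΦt, hs, hs, smul_zero, add_zero]
  refine ⟨fun g => Φ g 0, fun g a => ?_, fun g => ?_⟩
  · change Φ (g * α a) 0 = Φ g 0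
    rw [map_mul, Equiv.Perm.mul_apply, hΦα, hβ, smul_zero]
  · have : g ∈ H := hH ▸ Subgroup.mem_top g
    change Φ (g * t) 0 = Φ g 0 + g • m
    rw [map_mul, Equiv.Perm.mul_apply, hΦt, hs, smul_zero, add_zero, this m]

/-- The first homology of the relative Cayley complex vanishes. -/
theorem exists_bd₂_eq (hG : IsRelPres α t S k) {e : G →₀ ℤ} (he : bd₁ α t e = 0) :
    ∃ f, bd₂ α t S k f = e := by
  let N := (bd₂ α t S k).range
  let _ : DistribMulAction G ((G →₀ ℤ) ⧸ N) := quotientAction N (by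
    rintro g _ ⟨f, rfl⟩
    exact ⟨g • f, hG.bd₂_smul g f⟩)
  let π : (G →₀ ℤ) →+ (G →₀ ℤ) ⧸ N := QuotientAddGroup.mk' N
  have hπ : ∀ (g : G) x, g • π x = π (g • x) := fun g x => rfl
  obtain ⟨d, hdα, hdt⟩ := hG.exists_derivation (π (Finsupp.single 1 1)) fun w hw => by
    have h1 : π (faceCycle α t k w 1) = 0 :=
      (QuotientAddGroup.eq_zero_iff _).mpr
        ⟨Finsupp.single ⟨⟨w, hw⟩, ((1 : G) : G ⧸ Subgroup.zpowers (α w * t))⟩ 1, by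
          rw [hG.bd₂_single ⟨w, hw⟩, one_smul]⟩
    simpa [faceCycle, hπ] using h1
  let s : (G ⧸ α.range →₀ ℤ) →+ (G →₀ ℤ) ⧸ N :=
    Finsupp.liftAddHom fun q => zmultiplesHom _ (d q.out)
  have hs : ∀ (u : G) (z : ℤ), s (Finsupp.single (u : G ⧸ α.range) z) = z • d u := by
    intro u z
    have h1 : ((u : G ⧸ α.range).out : G ⧸ α.range) = u := Quotient.out_eq' _
    obtain ⟨a, ha⟩ := QuotientGroup.eq.mp h1.symm
    have h2 : (u : G ⧸ α.range).out = u * α a := by rw [ha, mul_inv_cancel_left]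
    simp only [s, Finsupp.liftAddHom_apply_single, zmultiplesHom_apply]
    rw [h2, hdα]
  have hsπ : ∀ x, s (bd₁ α t x) = π x := by
    intro x
    induction x using Finsupp.induction_linear with
    | zero => simp
    | add f g hf hg => rw [map_add, map_add, hf, hg, map_add]
    | single g z =>
      rw [bd₁_single, map_sub, hs, hs, hdt, zsmul_add, add_sub_cancel_left, hπ, ← map_zsmul]
      simp
  have h1 : π e = 0 := by rw [← hsπ, he, map_zero]
  exact (QuotientAddGroup.eq_zero_iff _).mp h1

end IsRelPres

namespace IsRelPres

attribute [local instance] Finsupp.comapDistribMulAction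

open Finset Monoid

variable {A G : Type} [Group A] [Group G] {α : A →* G} {t : G} {S : Finset A} {k : ℕ}

open scoped Classical in
lemma faceCycle_apply (hG : IsRelPres α t S k) (hk : 0 < k) {w : A} (hw : w ∈ S) (u g : G) :
    faceCycle α t k w u g =
      if (u : G ⧸ Subgroup.zpowers (α w * t)) = (g * (α w)⁻¹ : G) then 1 else 0 := by
  split_ifs with h
  · rw [hG.faceCycle_eq_of_mk_eq hw h, faceCycle, Finsupp.finsetSum_apply, sum_eq_single 0]
    · simp
    · intro i hi hi0
      rw [Finsupp.single_apply, if_neg]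
      intro hg
      obtain ⟨χ, hχ, hχt⟩ := hG.exists_exponent
      have h1 : (α w * t) ^ (i : ℤ) = 1 := by
        rw [zpow_natCast]
        have h2 : g * (α w)⁻¹ * (α w * t) ^ i = g * (α w)⁻¹ := by
          rw [eq_mul_inv_iff_mul_eq, hg]
        simpa using h2
      rw [hG.zpow_eq_one_iff hw hχ hχt, exponent_pow hχ hχt, ofAdd_eq_one, Int.cast_natCast,
        ZMod.natCast_eq_zero_iff] at h1
      exact hi0 (Nat.eq_zero_of_dvd_of_lt h1 (mem_range.mp hi))
    · intro h0
      exact absurd (mem_range.mpr hk) h0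
  · rw [faceCycle, Finsupp.finsetSum_apply]
    refine sum_eq_zero fun i _ => ?_
    rw [Finsupp.single_apply, if_neg]
    rintro rfl
    apply h
    rw [mul_inv_cancel_right, QuotientGroup.eq, inv_mul_cancel_left]
    exact Subgroup.pow_mem _ (Subgroup.mem_zpowers _) i

lemma bd₂_apply (hG : IsRelPres α t S k) (hk : 0 < k) (f : Face α t S →₀ ℤ) (g : G) :
    bd₂ α t S k f g =
      ∑ w : {w : A // w ∈ S}, f ⟨w, ((g * (α w)⁻¹ : G) : G ⧸ Subgroup.zpowers (α w * t))⟩ := by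
  classical
  induction f using Finsupp.induction_linear with
  | zero => simp
  | add f f' hf hf' => simp [hf, hf', sum_add_distrib]
  | single σ z =>
    obtain ⟨w, q⟩ := σ
    obtain ⟨u, rfl⟩ := QuotientGroup.mk_surjective q
    rw [hG.bd₂_single, Finsupp.smul_apply, hG.faceCycle_apply hk w.2, sum_eq_single w]
    · simp [Finsupp.single_apply]
    · intro w' _ hw'
      rw [Finsupp.single_apply, if_neg]
      intro h
      exact hw' (congrArg Sigma.fst h).symm
    · simp

lemma exists_ne_of_bd₂_eq_zero (hG : IsRelPres α t S k) (hk : 0 < k) {f : Face α t S →₀ ℤ}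
    (hf : bd₂ α t S k f = 0) {g : G} {w : {w : A // w ∈ S}}
    (hw : f ⟨w, ((g * (α w)⁻¹ : G) : G ⧸ Subgroup.zpowers (α w * t))⟩ ≠ 0) :
    ∃ w' : {w : A // w ∈ S}, w' ≠ w ∧
      f ⟨w', ((g * (α w')⁻¹ : G) : G ⧸ Subgroup.zpowers (α w' * t))⟩ ≠ 0 := by
  by_contra! h
  have h1 := hG.bd₂_apply hk f g
  rw [hf, sum_eq_single w (fun w' _ hw' => h w' hw') (by simp)] at h1
  exact hw h1.symm

/-- The faces in the component of the face `⟨w, u (α w)⁻¹⟩` under adjacency along edges. -/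
def treeFace (α : A →* G) (t : G) (S : Finset A) (u : G) (p : Dbl A × {w : A // w ∈ S}) :
    Face α t S :=
  ⟨p.2, ((u * (theta α t p.1)⁻¹ * (α p.2)⁻¹ : G) : G ⧸ Subgroup.zpowers (α p.2 * t))⟩

lemma treeFace_injective [IsMulTorsionFree A] (hG : IsRelPres α t S k) (hk : 4 ≤ k) (u : G) :
    Function.Injective (treeFace α t S u) := by
  rintro ⟨y, w⟩ ⟨z, w'⟩ h
  obtain rfl : w = w' := congrArg Sigma.fst h
  have h1 := QuotientGroup.eq.mp (eq_of_heq (Sigma.mk.inj h).2)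
  obtain ⟨i, hi⟩ := h1
  simp only at hi
  obtain ⟨χ, hχ, hχt⟩ := hG.exists_exponent
  have h2 : (α w * t) ^ i = 1 := by
    rw [hG.zpow_eq_one_iff w.2 hχ hχt, hi]
    simp [hχ, exponent_theta hχ]
  rw [h2] at hi
  have h3 : theta α t y = theta α t z := by
    have h4 := congrArg (fun x => (α w)⁻¹ * x * α w) hi
    simp only [mul_inv_rev, inv_inv, mul_assoc, inv_mul_cancel_left, inv_mul_cancel, mul_one] at h4
    exact (mul_inv_eq_one.mp h4.symm)
  rw [hG.theta_injective hk h3]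

/-- Adjacent faces along the edges crossed by the `i`-th factor of `Dbl A`. -/
lemma exists_treeFace_step (hG : IsRelPres α t S k) (hk : 0 < k) {f : Face α t S →₀ ℤ}
    (hf : bd₂ α t S k f = 0) {u : G} {z : Dbl A} {w : {w : A // w ∈ S}}
    (hw : f (treeFace α t S u (z, w)) ≠ 0) (i : Bool) :
    ∃ a : A, a ≠ 1 ∧ ∃ w' : {w : A // w ∈ S},
      f (treeFace α t S u (CoprodI.of (M := fun _ : Bool => A) (i := i) a * z, w')) ≠ 0 := by
  have hmk : ∀ (w : A) (u v : G), u * (α w * t) = v →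
      (v : G ⧸ Subgroup.zpowers (α w * t)) = u := by
    rintro w u _ rfl
    rw [eq_comm, QuotientGroup.eq, inv_mul_cancel_left]
    exact Subgroup.mem_zpowers _
  cases i
  · let g := u * (theta α t z)⁻¹ * (α w)⁻¹ * t⁻¹
    have hface : ∀ w' : {w : A // w ∈ S},
        (⟨w', ((g * (α w')⁻¹ : G) : G ⧸ Subgroup.zpowers (α w' * t))⟩ : Face α t S) =
        treeFace α t S u (CoprodI.of (M := fun _ : Bool => A) (i := false)
          ((w' : A)⁻¹ * w) * z, w') := by
      intro w'
      refine congrArg (Sigma.mk w') (hmk _ _ _ ?_).symm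
      simp only [g, map_mul, theta_false, map_inv]
      group
    obtain ⟨w', hne, hw'⟩ := hG.exists_ne_of_bd₂_eq_zero hk hf (g := g) (w := w) (by
      rw [hface]; simpa using hw)
    refine ⟨(w' : A)⁻¹ * w, ?_, w', by rwa [← hface]⟩
    rw [Ne, inv_mul_eq_one]
    exact fun h => hne (Subtype.ext h)
  · let g := u * (theta α t z)⁻¹ * t * α w
    have hface : ∀ w' : {w : A // w ∈ S},
        (⟨w', ((g * (α w')⁻¹ : G) : G ⧸ Subgroup.zpowers (α w' * t))⟩ : Face α t S) =
        treeFace α t S u (CoprodI.of (M := fun _ : Bool => A) (i := true)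
          ((w' : A) * (w : A)⁻¹) * z, w') := by
      intro w'
      refine congrArg (Sigma.mk w') (hmk _ _ _ ?_)
      simp only [g, map_mul, theta_true, map_inv]
      group
    obtain ⟨w', hne, hw'⟩ := hG.exists_ne_of_bd₂_eq_zero hk hf (g := g) (w := w) (by
      rw [hface]; simpa using hw)
    refine ⟨(w' : A) * (w : A)⁻¹, ?_, w', by rwa [← hface]⟩
    rw [Ne, mul_inv_eq_one]
    exact fun h => hne (Subtype.ext h)

/-- The second homology of the relative Cayley complex vanishes. -/
theorem bd₂_injective [IsMulTorsionFree A] (hG : IsRelPres α t S k) (hk : 4 ≤ k) :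
    Function.Injective (bd₂ α t S k) := by
  rw [injective_iff_map_eq_zero]
  intro f hf
  by_contra hne
  obtain ⟨⟨w₀, q⟩, hσ⟩ := Finsupp.ne_iff.mp hne
  obtain ⟨u, rfl⟩ := QuotientGroup.mk_surjective q
  let F := treeFace α t S (u * α w₀)
  have hfin : {p | f (F p) ≠ 0}.Finite := by
    have h1 : {p | f (F p) ≠ 0} = F ⁻¹' (f.support : Set (Face α t S)) := by
      ext p
      simp
    rw [h1]
    exact f.support.finite_toSet.preimage (hG.treeFace_injective hk _).injOn
  have hmem : ((1, w₀) : Dbl A × {w : A // w ∈ S}) ∈ {p | f (F p) ≠ 0} := by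
    have h1 : F (1, w₀) = ⟨w₀, u⟩ := by simp [F, treeFace]
    simpa [h1] using hσ
  obtain ⟨⟨z, w⟩, hzw, hmax⟩ := hfin.exists_maximalFor (fun p => Dbl.len p.1) _ ⟨_, hmem⟩
  obtain ⟨i, hi⟩ := Dbl.exists_len_lt z
  obtain ⟨a, ha, w', hw'⟩ := hG.exists_treeFace_step (by omega) hf hzw i
  exact absurd (hmax hw' (hi a ha).le) (not_le.mpr (hi a ha))

end IsRelPres

namespace IsRelPres

attribute [local instance] Finsupp.comapDistribMulAction

open Finset PermModule

variable {A G : Type} [Group A] [Group G] {α : A →* G} {t : G} {S : Finset A} {k : ℕ}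

lemma aug_cyclicNorm {X : Type} [MulAction G X] (h : G) (p : ℕ) (x : X →₀ ℤ) :
    aug X (cyclicNorm h p x) = p * aug X x := by
  simp [cyclicNorm, aug_smul]

lemma smul_vertex_ne [IsMulTorsionFree A] (hG : IsRelPres α t S k) (hk : 4 ≤ k) {h : G} {p : ℕ}
    (hp : p ≠ 0) (hhp : h ^ p = 1) (hh : h ≠ 1) (v : G ⧸ α.range) : h • v ≠ v := by
  obtain ⟨u, rfl⟩ := QuotientGroup.mk_surjective v
  intro hu
  rw [MulAction.Quotient.smul_coe, eq_comm, QuotientGroup.eq] at hu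
  obtain ⟨a, ha⟩ := hu
  have ha' : α a = u⁻¹ * h * u⁻¹⁻¹ := by rw [ha, smul_eq_mul]; group
  have h1 : α (a ^ p) = α 1 := by
    rw [map_pow, ha', conj_pow, hhp]
    simp
  have h2 : a = 1 := IsMulTorsionFree.pow_left_injective hp (by
    simpa using hG.alpha_injective hk h1)
  rw [h2, map_one, eq_comm, conj_eq_one_iff] at ha'
  exact hh ha'

lemma exists_smul_face_eq [IsMulTorsionFree A] (hG : IsRelPres α t S k) (hk : 4 ≤ k) {h : G}
    {p : ℕ} (hp : p.Prime) (hhp : h ^ p = 1) (hh : h ≠ 1) : ∃ σ : Face α t S, h • σ = σ := by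
  by_contra! hfix
  let v : G ⧸ α.range →₀ ℤ := Finsupp.single ((1 : G) : G ⧸ α.range) 1
  obtain ⟨e, he⟩ := hG.exists_bd₁_eq (v := v - h • v) (by rw [map_sub, aug_smul, sub_self])
  obtain ⟨f, hf⟩ := hG.exists_bd₂_eq (e := cyclicNorm h p e) (by
    rw [map_cyclicNorm bd₁_smul, he, cyclicNorm_sub_smul hhp])
  obtain ⟨f', rfl⟩ := exists_eq_cyclicNorm hp hhp hfix (f := f) (by
    apply hG.bd₂_injective hk
    rw [hG.bd₂_smul, hf, smul_cyclicNorm hhp])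
  obtain ⟨e', he'⟩ := exists_eq_sub hp.pos hhp (f := e - bd₂ α t S k f') (by
    rw [cyclicNorm_sub, ← map_cyclicNorm hG.bd₂_smul, hf, sub_self])
  obtain ⟨v', hv'⟩ := exists_eq_cyclicNorm hp hhp (hG.smul_vertex_ne hk hp.ne_zero hhp hh)
    (f := v - bd₁ α t e') (by
      have h1 := congrArg (bd₁ α t) he'
      rw [map_sub, hG.bd₁_bd₂, he, sub_zero, map_sub, bd₁_smul] at h1
      rw [smul_sub, sub_eq_sub_iff_sub_eq_sub, ← neg_sub, h1, neg_sub])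
  have h1 := congrArg (aug _) hv'
  rw [map_sub, aug_bd₁, aug_cyclicNorm, sub_zero, aug_single] at h1
  exact hp.one_lt.ne' (by exact_mod_cast Int.eq_one_of_dvd_one (by positivity) ⟨_, h1⟩)

lemma exists_cyclicNorm_eq_of_smul_face_eq (hG : IsRelPres α t S k)
    {h : G} {p : ℕ} (hp : p.Prime) (hhp : h ^ p = 1) (hh : h ≠ 1) {σ : Face α t S}
    (hσ : h • σ = σ) :
    ∃ e v, bd₂ α t S k (Finsupp.single σ 1) = cyclicNorm h p e ∧ bd₁ α t e = v - h • v := by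
  obtain ⟨e, he⟩ := exists_eq_cyclicNorm hp hhp (X := G) (fun x hx => hh (by simpa using hx))
    (f := bd₂ α t S k (Finsupp.single σ 1)) (by
      rw [← hG.bd₂_smul, Finsupp.comapSMul_single, hσ])
  obtain ⟨v, hv⟩ := exists_eq_sub hp.pos hhp (f := bd₁ α t e) (by
    rw [← map_cyclicNorm bd₁_smul, ← he, hG.bd₁_bd₂])
  exact ⟨e, v, he, hv⟩

lemma exists_isCoprime_mul_add_mul_eq_zero (x y : ℤ) :
    ∃ a b : ℤ, IsCoprime a b ∧ a * x + b * y = 0 := by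
  rcases (Int.gcd x y).eq_zero_or_pos with h | h
  · rw [Int.gcd_eq_zero_iff] at h
    exact ⟨1, 0, isCoprime_one_left, by simp [h.1]⟩
  · obtain ⟨x', y', hxy, hx, hy⟩ := Int.exists_gcd_one h
    refine ⟨y', -x', (Int.isCoprime_iff_gcd_eq_one.mpr hxy).symm.neg_right, ?_⟩
    linear_combination y' * hx - x' * hy

lemma smul_face_eq_unique [IsMulTorsionFree A] (hG : IsRelPres α t S k) (hk : 4 ≤ k)
    {h : G} {p : ℕ} (hp : p.Prime) (hhp : h ^ p = 1) (hh : h ≠ 1) {σ τ : Face α t S}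
    (hσ : h • σ = σ) (hτ : h • τ = τ) : σ = τ := by
  by_contra hne
  obtain ⟨e₁, v₁, he₁, hv₁⟩ := hG.exists_cyclicNorm_eq_of_smul_face_eq hp hhp hh hσ
  obtain ⟨e₂, v₂, he₂, hv₂⟩ := hG.exists_cyclicNorm_eq_of_smul_face_eq hp hhp hh hτ
  obtain ⟨a, b, hab, hv⟩ := exists_isCoprime_mul_add_mul_eq_zero (aug _ v₁) (aug _ v₂)
  obtain ⟨e, he⟩ := hG.exists_bd₁_eq (v := a • v₁ + b • v₂) (by
    rw [map_add, map_zsmul, map_zsmul, smul_eq_mul, smul_eq_mul, hv])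
  obtain ⟨f, hf⟩ := hG.exists_bd₂_eq (e := a • e₁ + b • e₂ - (e - h • e)) (by
    rw [map_sub, map_add, map_sub, map_zsmul, map_zsmul, bd₁_smul, he, hv₁, hv₂, smul_add,
      smul_comm h a v₁, smul_comm h b v₂, zsmul_sub, zsmul_sub]
    abel)
  have key : a • Finsupp.single σ 1 + b • Finsupp.single τ 1 = cyclicNorm h p f := by
    apply hG.bd₂_injective hk
    rw [map_cyclicNorm hG.bd₂_smul, hf, cyclicNorm_sub, cyclicNorm_sub_smul hhp, cyclicNorm_add,
      cyclicNorm_zsmul, cyclicNorm_zsmul, map_add, map_zsmul, map_zsmul, he₁, he₂, sub_zero]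
  have hdvd : ∀ ρ : Face α t S, h • ρ = ρ → (p : ℤ) ∣ cyclicNorm h p f ρ := by
    intro ρ hρ
    have h1 : ∀ i : ℕ, (h ^ i)⁻¹ • ρ = ρ := fun i => by
      rw [inv_smul_eq_iff, eq_comm]
      induction i with
      | zero => simp
      | succ i ih => rw [pow_succ, mul_smul, hρ]; exact ih
    refine ⟨f ρ, ?_⟩
    simp [cyclicNorm, Finsupp.finsetSum_apply, h1]
  have ha : (p : ℤ) ∣ a := by
    simpa [← key, Finsupp.single_apply, Ne.symm hne] using hdvd σ hσ
  have hb : (p : ℤ) ∣ b := by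
    simpa [← key, Finsupp.single_apply, hne] using hdvd τ hτ
  exact (Nat.prime_iff_prime_int.mp hp).not_isUnit (hab.isUnit_of_dvd' ha hb)

/-- Torsion elements are conjugate into the cyclic groups generated by the roots of the
relators. -/
theorem exists_eq_conj_zpow [IsMulTorsionFree A] (hG : IsRelPres α t S k) (hk : 4 ≤ k)
    {g : G} (hg : IsOfFinOrder g) (hg1 : g ≠ 1) :
    ∃ w ∈ S, ∃ (u : G) (j : ℤ), g = u * (α w * t) ^ j * u⁻¹ := by
  obtain ⟨p, hp, hpd⟩ := Nat.exists_prime_and_dvd (mt orderOf_eq_one_iff.mp hg1)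
  obtain ⟨d, hd⟩ := hpd
  have hpos := hg.orderOf_pos
  have hhp : (g ^ d) ^ p = 1 := by rw [← pow_mul, mul_comm, ← hd, pow_orderOf_eq_one]
  have hh : g ^ d ≠ 1 := by
    refine pow_ne_one_of_lt_orderOf ?_ ?_
    · rintro rfl
      omega
    · rw [hd]
      have : 0 < d := Nat.pos_of_ne_zero (by rintro rfl; omega)
      nlinarith [hp.one_lt]
  obtain ⟨σ, hσ⟩ := hG.exists_smul_face_eq hk hp hhp hh
  have hgσ : g • σ = σ := hG.smul_face_eq_unique hk hp hhp hh (by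
    rw [smul_smul, ← pow_succ, pow_succ', mul_smul, hσ]) hσ
  obtain ⟨w, q⟩ := σ
  obtain ⟨u, rfl⟩ := QuotientGroup.mk_surjective q
  have h1 : ((g * u : G) : G ⧸ Subgroup.zpowers (α w * t)) = u := eq_of_heq (Sigma.mk.inj hgσ).2
  obtain ⟨j, hj⟩ := QuotientGroup.eq.mp h1.symm
  refine ⟨w, w.2, u, j, ?_⟩
  simp only at hj
  rw [hj]
  group

end IsRelPres

section PtkRels

variable {m n k : ℕ} (r : Fin n → Word (Fin m))

/-- The homomorphism from the free group on `x₁,…,x_m` to the group presented by `P_t^k`. -/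
def ptkHom (k : ℕ) : FreeGroup (Fin m) →* PresentedGroup (PtkRels m n k r) :=
  FreeGroup.lift fun x => PresentedGroup.of (Sum.inl x)

lemma rho_eq_map (i : Fin n) : rho r i = FreeGroup.map Sum.inl (FreeGroup.mk (r i)) := by
  simp [rho]

lemma ptkHom_apply (a : FreeGroup (Fin m)) :
    ptkHom r k a = PresentedGroup.mk (PtkRels m n k r) (FreeGroup.map Sum.inl a) := by
  have h : ptkHom r k =
      (PresentedGroup.mk (PtkRels m n k r)).comp (FreeGroup.map Sum.inl) := by
    ext x
    simp [ptkHom, PresentedGroup.of]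
  rw [h, MonoidHom.comp_apply]

/-- The relators of `P` together with the trivial word. -/
noncomputable def ptkRoots : Finset (FreeGroup (Fin m)) :=
  open scoped Classical in insert 1 (Finset.univ.image fun i => FreeGroup.mk (r i))

lemma mem_ptkRoots {w : FreeGroup (Fin m)} :
    w ∈ ptkRoots r ↔ w = 1 ∨ ∃ i, FreeGroup.mk (r i) = w := by
  simp [ptkRoots]

lemma isRelPres_ptk (k : ℕ) :
    IsRelPres (ptkHom r k) (PresentedGroup.mk (PtkRels m n k r) (tGen m)) (ptkRoots r) k where
  rel w hw := by
    rcases (mem_ptkRoots r).mp hw with rfl | ⟨i, rfl⟩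
    · rw [map_one, one_mul, ← map_pow]
      exact PresentedGroup.one_of_mem (Or.inr rfl)
    · rw [ptkHom_apply, ← rho_eq_map, ← map_mul, ← map_pow]
      exact PresentedGroup.one_of_mem (Or.inl ⟨i, rfl⟩)
  univ H _ β s h := by
    let f : Fin m ⊕ Unit → H := Sum.elim (fun x => β (FreeGroup.of x)) fun _ => s
    have hf : ∀ a, FreeGroup.lift f (FreeGroup.map Sum.inl a) = β a := by
      intro a
      have h1 : (FreeGroup.lift f).comp (FreeGroup.map Sum.inl) = β := by
        ext x
        simp [f]
      rw [← h1, MonoidHom.comp_apply]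
    have ht : FreeGroup.lift f (tGen m) = s := by simp [tGen, f]
    have hrel : ∀ x ∈ PtkRels m n k r, FreeGroup.lift f x = 1 := by
      rintro _ (⟨i, rfl⟩ | rfl)
      · simp only [map_pow, map_mul, rho_eq_map, hf, ht]
        exact h _ ((mem_ptkRoots r).mpr (Or.inr ⟨i, rfl⟩))
      · rw [map_pow, ht]
        simpa using h 1 ((mem_ptkRoots r).mpr (Or.inl rfl))
    refine ⟨PresentedGroup.toGroup hrel, fun a => ?_, ht⟩
    rw [ptkHom_apply]
    exact hf a
  gen H hα ht := by
    refine (Subgroup.eq_top_iff' H).mpr fun x => PresentedGroup.generated_by _ H ?_ x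
    rintro (x | _)
    · simpa [ptkHom] using hα (FreeGroup.of x)
    · exact ht

end PtkRels

/-- Lemma: for `P = ⟨x₁,…,x_m | r₁,…,rₙ⟩` with all relators freely reduced, cyclically
reduced and distinct, and `k ≥ 12`, the subgroup `tor₁` of the group presented by
`P_t^k = ⟨x₁,…,x_m,t | (r₁t)^k,…,(rₙt)^k, t^k⟩` is the normal closure of (the images of)
`r₁t, …, rₙt, t`. -/
theorem tor_one_ptk {m n k : ℕ} (hk : 12 ≤ k) (r : Fin n → Word (Fin m))
    (hred : ∀ i, Reduced (r i)) (hcyc : ∀ i, CyclicallyReduced (r i))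
    (hdist : Function.Injective r) :
    torOne (PresentedGroup (PtkRels m n k r)) =
      Subgroup.normalClosure
        ((Set.range fun i => PresentedGroup.mk (PtkRels m n k r) (rho r i * tGen m)) ∪
          {PresentedGroup.mk (PtkRels m n k r) (tGen m)}) := by

  have hG := isRelPres_ptk r k
  apply le_antisymm
  · refine Subgroup.normalClosure_le_normal fun g hg => ?_
    by_cases hg1 : g = 1
    · rw [hg1]
      exact Subgroup.one_mem _
    obtain ⟨w, hw, u, j, rfl⟩ := hG.exists_eq_conj_zpow (by omega) hg hg1
    refine Subgroup.normalClosure_normal.conj_mem _ (Subgroup.zpow_mem _ ?_ j) u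
    apply Subgroup.subset_normalClosure
    rcases (mem_ptkRoots r).mp hw with rfl | ⟨i, rfl⟩
    · exact Or.inr (by rw [map_one, one_mul, Set.mem_singleton_iff])
    · exact Or.inl ⟨i, by rw [ptkHom_apply, ← rho_eq_map, ← map_mul]⟩
  · refine Subgroup.normalClosure_mono ?_
    rintro _ (⟨i, rfl⟩ | rfl) <;>
      refine isOfFinOrder_iff_pow_eq_one.mpr ⟨k, by omega, ?_⟩ <;>
      refine (map_pow _ _ _).symm.trans (PresentedGroup.one_of_mem ?_)
    · exact Or.inl ⟨i, rfl⟩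
    · exact Or.inr rfl
end

section
/- Let P = ⟨x₁,…,x_m | r₁,…,rₙ⟩ be a finite presentation in which each relator rᵢ is a freely reduced and cyclically reduced word and the rᵢ are pairwise distinct, let k ≥ 12, and let P̄_t^k denote the group presented by P_t^k = ⟨x₁,…,x_m,t | (r₁t)^k,…,(rₙt)^k, t^k⟩. Then the surjective homomorphism π : P̄_t^k → P̄ induced by xᵢ ↦ xᵢ and t ↦ 1 is well defined and its kernel equals tor₁(P̄_t^k); consequently π induces an isomorphism P̄_t^k / tor₁(P̄_t^k) ≅ P̄. -/
instance {G : Type*} [Group G] : (torOne G).Normal :=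
  Subgroup.normalClosure_normal

universe u

/-! ### Free families in free products and amalgams -/

theorem equivPair_head_eq_one_of_ne {ι : Type*} {M : ι → Type*} [∀ i, Monoid (M i)]
    [DecidableEq ι] [∀ i, DecidableEq (M i)] {i j : ι} (hij : i ≠ j) (w : Monoid.CoprodI.Word M)
    (h : (Monoid.CoprodI.Word.equivPair i w).head ≠ 1) :
    (Monoid.CoprodI.Word.equivPair j w).head = 1 := by
  rw [Monoid.CoprodI.Word.equivPair_head] at h ⊢
  split_ifs at h with h₁
  · rw [dif_neg]
    rintro ⟨h₂, h₃⟩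
    exact hij (h₁.2.symm.trans h₃)
  · exact absurd rfl h

/-- In the free product of two copies of `H`, the products of the two copies of the nontrivial
elements of `H` freely generate a free group. -/
theorem lift_diagonal_injective (H : Type*) [Group H] [Nontrivial {h : H // h ≠ 1}] :
    Function.Injective (FreeGroup.lift fun h : {h : H // h ≠ 1} =>
      (Monoid.CoprodI.of (M := fun _ : Bool => H) (i := true) h.1 *
        Monoid.CoprodI.of (i := false) h.1 : Monoid.CoprodI fun _ : Bool => H)) := by
  classical
  let hd (i : Bool) (w : Monoid.CoprodI.Word fun _ : Bool => H) : H :=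
    (Monoid.CoprodI.Word.equivPair i w).head
  have hd_smul (i : Bool) (g : H) (w : Monoid.CoprodI.Word fun _ : Bool => H) :
      hd i (Monoid.CoprodI.of (M := fun _ : Bool => H) (i := i) g • w) = g * hd i w := by
    simp only [hd, Monoid.CoprodI.Word.equivPair_smul_same]
  have hd_ne {i j : Bool} (hij : i ≠ j) (w : Monoid.CoprodI.Word fun _ : Bool => H)
      (h : hd i w ≠ 1) : hd j w = 1 := equivPair_head_eq_one_of_ne hij w h
  have key (i j : Bool) (hij : i ≠ j) (g : H) (hg : g ≠ 1)
      (w : Monoid.CoprodI.Word fun _ : Bool => H) (hw : hd j w ≠ g⁻¹) :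
      hd i (Monoid.CoprodI.of (M := fun _ : Bool => H) (i := i) g •
        Monoid.CoprodI.of (M := fun _ : Bool => H) (i := j) g • w) = g := by
    rw [hd_smul, hd_ne hij.symm, mul_one]
    rw [hd_smul]
    exact fun h => hw (eq_inv_of_mul_eq_one_right h)
  have hd_empty (i : Bool) : hd i Monoid.CoprodI.Word.empty = 1 := by
    simp [hd, Monoid.CoprodI.Word.equivPair_head, Monoid.CoprodI.Word.empty]
  refine FreeGroup.injective_lift_of_ping_pong
    (α := Monoid.CoprodI.Word fun _ : Bool => H) _
    (fun h => {w | hd true w = h.1}) (fun h => {w | hd false w = h.1⁻¹}) ?_ ?_ ?_ ?_ ?_ ?_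
  · rintro ⟨h, hh⟩
    refine ⟨Monoid.CoprodI.of (M := fun _ : Bool => H) (i := true) h •
      Monoid.CoprodI.Word.empty, ?_⟩
    simp only [Set.mem_ofPred_eq]
    rw [hd_smul, hd_empty, mul_one]
  · intro g h hgh
    refine Set.disjoint_left.2 fun w hw hw' => hgh (Subtype.ext ?_)
    exact Eq.trans (Eq.symm hw) hw'
  · intro g h hgh
    refine Set.disjoint_left.2 fun w hw hw' => hgh (Subtype.ext (inv_injective ?_))
    exact Eq.trans (Eq.symm hw) hw'
  · intro g h
    refine Set.disjoint_left.2 fun w hw hw' => ?_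
    simp only [Set.mem_ofPred_eq] at hw hw'
    have := hd_ne (i := true) (j := false) (by decide) w (by rw [hw]; exact g.2)
    rw [this] at hw'
    exact h.2 (inv_eq_one.1 hw'.symm)
  · rintro ⟨g, hg⟩ _ ⟨w, hw, rfl⟩
    simp only [Set.mem_ofPred_eq, Set.mem_compl_iff] at hw ⊢
    rw [mul_smul]
    exact key _ _ (by decide) g hg w hw
  · rintro ⟨g, hg⟩ _ ⟨w, hw, rfl⟩
    simp only [Set.mem_ofPred_eq, Set.mem_compl_iff] at hw ⊢
    rw [Pi.inv_apply, mul_inv_rev, mul_smul, ← map_inv, ← map_inv]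
    exact key _ _ (by decide) g⁻¹ (inv_ne_one.2 hg) w (by rwa [inv_inv])

/-- Every group `H` has four homomorphisms `φ₀, φ₁, φ₂, φ₃` to a common group such that
`φ₃ h * φ₂ h * φ₁ h * φ₀ h = 1` for all `h`, while the elements `φ₁ h * φ₀ h` with `h ≠ 1` freely
generate a free group. -/
theorem exists_four_homs (H : Type u) [Group H] [Nontrivial {h : H // h ≠ 1}] :
    ∃ (G : Type u) (_ : Group G) (φ : Fin 4 → H →* G) (c : FreeGroup {h : H // h ≠ 1} →* G),
      Function.Injective c ∧ (∀ h, c (FreeGroup.of h) = φ 1 h * φ 0 h) ∧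
        ∀ h, h ≠ 1 → φ 3 h * φ 2 h * (φ 1 h * φ 0 h) = 1 := by
  let d (i : Bool) : H →* Monoid.CoprodI (fun _ : Bool => H) :=
    Monoid.CoprodI.of (M := fun _ : Bool => H) (i := i)
  let w : FreeGroup {h : H // h ≠ 1} →* Monoid.CoprodI (fun _ : Bool => H) :=
    FreeGroup.lift fun h => d true h.1 * d false h.1
  let v : FreeGroup {h : H // h ≠ 1} →* FreeGroup {h : H // h ≠ 1} :=
    FreeGroup.lift fun h => (FreeGroup.of h)⁻¹
  have w_of h : w (FreeGroup.of h) = d true h.1 * d false h.1 := FreeGroup.lift_apply_of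
  have v_of h : v (FreeGroup.of h) = (FreeGroup.of h)⁻¹ := FreeGroup.lift_apply_of
  have hv : ∀ x, v (v x) = x := DFunLike.congr_fun
    (show v.comp v = MonoidHom.id _ from FreeGroup.ext_hom _ _ fun h => by simp [v_of])
  have hw : Function.Injective w := lift_diagonal_injective H
  let β : Bool → FreeGroup {h : H // h ≠ 1} →* Monoid.CoprodI (fun _ : Bool => H) :=
    fun i => if i then w else w.comp v
  have hβ : ∀ i, Function.Injective (β i) := by
    rintro (_ | _)
    · exact hw.comp (Function.LeftInverse.injective hv)
    · exact hw
  let o (i : Bool) : Monoid.CoprodI (fun _ : Bool => H) →* Monoid.PushoutI β :=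
    Monoid.PushoutI.of (φ := β) i
  have h₁ x : o true (w x) = Monoid.PushoutI.base β x :=
    Monoid.PushoutI.of_apply_eq_base β true x
  have h₀ x : o false (w (v x)) = Monoid.PushoutI.base β x :=
    Monoid.PushoutI.of_apply_eq_base β false x
  refine ⟨Monoid.PushoutI β, inferInstance,
    ![(o true).comp (d false), (o true).comp (d true),
      (o false).comp (d false), (o false).comp (d true)],
    Monoid.PushoutI.base β, Monoid.PushoutI.base_injective hβ, fun h => ?_, fun h hh => ?_⟩
  · rw [← h₁, w_of, map_mul]
    rfl
  · have e₁ := h₁ (FreeGroup.of ⟨h, hh⟩)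
    have e₀ := h₀ (FreeGroup.of ⟨h, hh⟩)⁻¹
    rw [map_inv v, v_of, inv_inv, w_of, map_inv, map_mul] at e₀
    rw [w_of, map_mul] at e₁
    change o false (d true h) * o false (d false h) * (o true (d true h) * o true (d false h)) = 1
    rw [e₀, e₁, inv_mul_cancel]

/-! ### The group presented by `⟨X, t | (s t)^k, s ∈ S⟩` -/

/-- The relators `(s t)^k`, `s ∈ S`, on the generators `α` together with a new generator `t`. -/
def coneRels {α : Type*} (S : Set (FreeGroup α)) (k : ℕ) : Set (FreeGroup (α ⊕ Unit)) :=
  (fun s => (FreeGroup.map Sum.inl s * FreeGroup.of (Sum.inr ())) ^ k) '' S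

/-- The group presented by the generators `α`, a new generator `t` and the relators `(s t)^k`,
`s ∈ S`. -/
abbrev ConeGroup {α : Type*} (S : Set (FreeGroup α)) (k : ℕ) := PresentedGroup (coneRels S k)

namespace ConeGroup

variable {α : Type u} (S : Set (FreeGroup α)) (k : ℕ)

/-- The homomorphism from the free group on the old generators. -/
def incl : FreeGroup α →* ConeGroup S k :=
  (PresentedGroup.mk (coneRels S k)).comp (FreeGroup.map Sum.inl)

/-- The new generator. -/
def apex : ConeGroup S k := PresentedGroup.of (Sum.inr ())

variable {S k}

theorem incl_mul_apex_pow (s : S) : (incl S k s * apex S k) ^ k = 1 :=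
  PresentedGroup.one_of_mem (rels := coneRels S k) (Set.mem_image_of_mem _ s.2)

theorem apex_mul_incl_pow (s : S) : (apex S k * incl S k s) ^ k = 1 := by
  have h : apex S k * incl S k s = apex S k * (incl S k s * apex S k) * (apex S k)⁻¹ := by group
  rw [h, conj_pow, incl_mul_apex_pow, mul_one, mul_inv_cancel]

theorem exists_hom {P : Type*} [Group P] (f : FreeGroup α →* P) (y : P)
    (h : ∀ s ∈ S, (f s * y) ^ k = 1) :
    ∃ Φ : ConeGroup S k →* P, (∀ x, Φ (incl S k x) = f x) ∧ Φ (apex S k) = y := by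
  let e : FreeGroup (α ⊕ Unit) →* P :=
    FreeGroup.lift (Sum.elim (fun a => f (FreeGroup.of a)) fun _ => y)
  have he : ∀ x, e (FreeGroup.map Sum.inl x) = f x := DFunLike.congr_fun
    (show e.comp (FreeGroup.map Sum.inl) = f from FreeGroup.ext_hom _ _ fun a => by simp [e])
  have hr : ∀ r ∈ coneRels S k, e r = 1 := by
    rintro _ ⟨s, hs, rfl⟩
    rw [map_pow, map_mul, he]
    simpa [e] using h s hs
  refine ⟨PresentedGroup.toGroup hr, fun x => ?_, ?_⟩
  · exact he x
  · simp [apex]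

/-- The permutation of `ZMod k × G` which shifts the first coordinate and multiplies the second
one by a factor depending on the first one. -/
def shiftPerm {G : Type*} [Group G] (f : ZMod k → G) : Equiv.Perm (ZMod k × G) where
  toFun p := (p.1 + 1, f p.1 * p.2)
  invFun p := (p.1 - 1, (f (p.1 - 1))⁻¹ * p.2)
  left_inv p := by simp
  right_inv p := by simp

theorem shiftPerm_pow_eq_one {G : Type*} [Group G] (hk : 4 ≤ k) (f : ℕ → G)
    (h₄ : ∀ n, 4 ≤ n → f n = 1) (h : f 3 * f 2 * (f 1 * f 0) = 1) :
    shiftPerm (k := k) (fun j => f j.val) ^ k = 1 := by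
  have : NeZero k := ⟨by omega⟩
  set T := shiftPerm (k := k) fun j => f j.val with hT
  have step (n : ℕ) (hn : n < k) (γ : G) :
      T ((n : ZMod k), γ) = (((n + 1 : ℕ) : ZMod k), f n * γ) := by
    simp [hT, shiftPerm, ZMod.val_cast_of_lt hn]
  have four (γ : G) : (T ^ 4) (0, γ) = (((4 : ℕ) : ZMod k), γ) := by
    have h0 := step 0 (by omega) γ
    have h1 := step 1 (by omega) (f 0 * γ)
    have h2 := step 2 (by omega) (f 1 * (f 0 * γ))
    have h3 := step 3 (by omega) (f 2 * (f 1 * (f 0 * γ)))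
    rw [Nat.cast_zero] at h0
    have e : f 3 * (f 2 * (f 1 * (f 0 * γ))) = γ := by
      simp only [← mul_assoc] at h ⊢
      rw [h, one_mul]
    simp only [pow_succ, pow_zero, one_mul, Equiv.Perm.mul_apply]
    rw [h0, h1, h2, h3, e]
  have far (n : ℕ) (hn : 4 ≤ n) (hnk : n ≤ k) (γ : G) : (T ^ n) (0, γ) = ((n : ZMod k), γ) := by
    induction n, hn using Nat.le_induction with
    | base => exact four γ
    | succ n hn ih =>
      rw [pow_succ', Equiv.Perm.mul_apply, ih (by omega), step n (by omega), h₄ n hn, one_mul]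
  have surj (n : ℕ) (hn : n ≤ k) (γ : G) : ∃ δ, (T ^ n) (0, δ) = ((n : ZMod k), γ) := by
    induction n generalizing γ with
    | zero => exact ⟨γ, by simp⟩
    | succ n ih =>
      obtain ⟨δ, hδ⟩ := ih (by omega) ((f n)⁻¹ * γ)
      refine ⟨δ, ?_⟩
      rw [pow_succ', Equiv.Perm.mul_apply, hδ, step n (by omega), mul_inv_cancel_left]
  ext1 ⟨j, γ⟩
  obtain ⟨δ, hδ⟩ := surj j.val (ZMod.val_lt j).le γ
  rw [ZMod.natCast_zmod_val] at hδ
  rw [← hδ, ← Equiv.Perm.mul_apply, pow_mul_comm, Equiv.Perm.mul_apply, far k hk le_rfl]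
  simp

theorem exists_action (hk : 4 ≤ k) :
    ∃ (G : Type u) (_ : Group G) (Φ : ConeGroup S k →* Equiv.Perm (ZMod k × G))
      (c : FreeGroup S →* G), Function.Injective c ∧
        ∀ (s : S) (γ : G), Φ ((apex S k * incl S k s) ^ 2) (0, γ) =
          (2, c (FreeGroup.of s) * γ) := by
  let H := FreeGroup α × Multiplicative ℤ
  let z (x : FreeGroup α) : H := (x, Multiplicative.ofAdd 1)
  have hz (x : FreeGroup α) : z x ≠ 1 := fun h => by simpa [z] using congrArg Prod.snd h
  have : Nontrivial {h : H // h ≠ 1} :=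
    ⟨⟨z 1, hz 1⟩, ⟨(1, Multiplicative.ofAdd 2), fun h => by simpa using congrArg Prod.snd h⟩,
      fun h => by simpa [z] using congrArg (fun x : {h : H // h ≠ 1} => x.1.2) h⟩
  obtain ⟨G, hG, φ, c, hc, h₂, h₄⟩ := exists_four_homs H
  let Λ (n : ℕ) : H →* G := if h : n < 4 then φ ⟨n, h⟩ else 1
  let μ (n : ℕ) : FreeGroup α →* G := (Λ n).comp (MonoidHom.inl _ _)
  let fib : FreeGroup α →* Equiv.Perm (ZMod k × G) :=
    { toFun := fun x =>
        { toFun := fun p => (p.1, μ p.1.val x * p.2)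
          invFun := fun p => (p.1, (μ p.1.val x)⁻¹ * p.2)
          left_inv := fun p => by simp
          right_inv := fun p => by simp }
      map_one' := Equiv.ext fun p => by simp
      map_mul' := fun x y => Equiv.ext fun p => by simp [mul_assoc] }
  let T : Equiv.Perm (ZMod k × G) := shiftPerm fun j => Λ j.val (z 1)
  have hT (x : FreeGroup α) : T * fib x = shiftPerm fun j => Λ j.val (z x) := by
    ext1 p
    have e (n : ℕ) : Λ n (z x) = Λ n (z 1) * μ n x := by
      rw [show z x = z 1 * MonoidHom.inl _ _ x from
        Prod.ext (one_mul x).symm (mul_one _).symm, map_mul]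
      rfl
    simp [T, fib, shiftPerm, e, mul_assoc]
  have hpow (x : FreeGroup α) : (T * fib x) ^ k = 1 := by
    rw [hT]
    refine shiftPerm_pow_eq_one hk (fun n => Λ n (z x)) (fun n hn => ?_) ?_
    · simp [Λ, hn.not_gt]
    · exact h₄ _ (hz x)
  obtain ⟨Φ, hΦ, hΦT⟩ := exists_hom (S := S) (k := k) fib T fun s _ => by
    have h : fib s * T = T⁻¹ * (T * fib s) * T⁻¹⁻¹ := by group
    rw [h, conj_pow, hpow, mul_one, mul_inv_cancel]
  refine ⟨G, hG, Φ, c.comp (FreeGroup.map fun s => ⟨z s, hz s⟩), ?_, fun s γ => ?_⟩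
  · refine hc.comp (FreeGroup.map_injective fun s s' h => ?_)
    have := congrArg (fun x : {h : H // h ≠ 1} => x.1.1) h
    exact Subtype.ext this
  · have : Fact (1 < k) := ⟨by omega⟩
    rw [map_pow, map_mul, hΦ, hΦT, hT, pow_two, Equiv.Perm.mul_apply]
    have e : Λ 1 (z s) * Λ 0 (z s) = c (FreeGroup.of ⟨z s, hz s⟩) := (h₂ ⟨z s, hz s⟩).symm
    simp [shiftPerm, ← e, mul_assoc, ZMod.val_one, one_add_one_eq_two]

theorem toWord_of_mul_inv_of_mul {β : Type*} [DecidableEq β] {s s' : β} (hs : s' ≠ s)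
    {x : FreeGroup β} (hx : x.toWord.head? ≠ some (s, true)) :
    (FreeGroup.of s' * (FreeGroup.of s)⁻¹ * x).toWord = (s', true) :: (s, false) :: x.toWord := by
  have h : FreeGroup.of s' * (FreeGroup.of s)⁻¹ * x
      = FreeGroup.mk ((s', true) :: (s, false) :: x.toWord) := by
    conv_lhs => rw [← FreeGroup.mk_toWord (x := x)]
    rfl
  rw [h, FreeGroup.toWord_mk]
  apply FreeGroup.IsReduced.reduce_eq
  have hr := FreeGroup.isReduced_toWord (x := x)
  unfold FreeGroup.IsReduced at hr ⊢
  generalize x.toWord = L at hr hx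
  cases L with
  | nil => simp [hs]
  | cons a L =>
    obtain ⟨a, b⟩ := a
    simp only [List.isChain_cons_cons]
    refine ⟨fun e => absurd e hs, fun e => ?_, hr⟩
    cases b
    · rfl
    · exact absurd (by simp_all) hx

/-- A finitely supported family of functions on the cone group, the one with index `s` being
invariant under right multiplication by `apex * s`, vanishes as soon as no element of the group lies
in exactly one of the supports. -/
theorem eq_zero_of_supports_overlap (hk : 4 ≤ k) {h : S → ConeGroup S k → ℤ}
    (hfin : {q | ∃ s, h s q ≠ 0}.Finite)
    (hinv : ∀ s q, h s (q * (apex S k * incl S k s)) = h s q)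
    (hne : ∀ q s, h s q ≠ 0 → ∃ s', s' ≠ s ∧ h s' q ≠ 0) : h = 0 := by
  classical
  by_contra hh
  obtain ⟨s₀, hs₀⟩ := Function.ne_iff.1 hh
  obtain ⟨q₀, hq₀⟩ := Function.ne_iff.1 hs₀
  obtain ⟨G, _, Φ, c, hc, hΦ⟩ := exists_action (S := S) hk
  have hinv₂ (s q) : h s (q * (apex S k * incl S k s) ^ 2) = h s q := by
    rw [pow_two, ← mul_assoc, hinv, hinv]
  let T : Set (ConeGroup S k × FreeGroup S) :=
    {p | (∃ s, h s p.1 ≠ 0) ∧ Φ (p.1⁻¹ * q₀) (2, 1) = (2, c p.2)}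
  have hT : T.Finite := by
    refine Set.Finite.of_finite_image (f := Prod.fst)
      (hfin.subset (by rintro _ ⟨p, hp, rfl⟩; exact hp.1)) ?_
    rintro ⟨q, x⟩ hx ⟨q', y⟩ hy (rfl : q = q')
    have := hx.2.symm.trans hy.2
    exact Prod.ext rfl (hc (congrArg Prod.snd this))
  have h₀ : (q₀, 1) ∈ T := ⟨⟨s₀, hq₀⟩, by simp⟩
  obtain ⟨⟨q, x⟩, ⟨⟨s₁, hs₁⟩, hqx⟩, hmax⟩ :=
    Set.exists_max_image T (fun p => p.2.norm) hT ⟨_, h₀⟩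
  obtain ⟨s, hs, hsx⟩ : ∃ s, h s q ≠ 0 ∧ x.toWord.head? ≠ some (s, true) := by
    by_cases hx : x.toWord.head? = some (s₁, true)
    · obtain ⟨s₂, h₂, hs₂⟩ := hne q s₁ hs₁
      exact ⟨s₂, hs₂, by rw [hx]; simpa using h₂.symm⟩
    · exact ⟨s₁, hs₁, hx⟩
  obtain ⟨s', hss', hs'⟩ := hne (q * (apex S k * incl S k s) ^ 2) s (by rwa [hinv₂])
  set w := (apex S k * incl S k s) ^ 2 with hw
  set w' := (apex S k * incl S k s') ^ 2 with hw'
  have hmem : (q * w * w'⁻¹, FreeGroup.of s' * (FreeGroup.of s)⁻¹ * x) ∈ T := by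
    refine ⟨⟨s', ?_⟩, ?_⟩
    · rwa [← hinv₂, inv_mul_cancel_right]
    · have e : (q * w * w'⁻¹)⁻¹ * q₀ = w' * (w⁻¹ * (q⁻¹ * q₀)) := by group
      have e' : Φ w⁻¹ (2, c x) = (0, (c (FreeGroup.of s))⁻¹ * c x) := by
        rw [map_inv, Equiv.Perm.inv_eq_iff_eq, hw, hΦ, mul_inv_cancel_left]
      simp only at hqx ⊢
      rw [e, map_mul, map_mul Φ w⁻¹, Equiv.Perm.mul_apply, Equiv.Perm.mul_apply, hqx, e', hΦ]
      simp [mul_assoc]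
  have := hmax _ hmem
  simp only [FreeGroup.norm, toWord_of_mul_inv_of_mul hss' hsx, List.length_cons] at this
  omega

open MonoidAlgebra in
/-- The relation module of the cone group has no relations: this is the vanishing of the kernel of
the differential, expressed through the coordinate of the new generator. -/
theorem eq_zero_of_sum_mul_incl_eq_zero [Fintype S] (hk : 4 ≤ k)
    {b : S → MonoidAlgebra ℤ (ConeGroup S k)}
    (hb : ∀ s : S, b s * of ℤ _ (incl S k s * apex S k) = b s)
    (h : ∑ s, b s * of ℤ _ (incl S k s) = 0) : b = 0 := by
  have coeff_mul_of (x : MonoidAlgebra ℤ (ConeGroup S k)) (g q) :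
      (x * of ℤ _ g).coeff q = x.coeff (q * g⁻¹) := by
    rw [of_apply, coeff_mul_single_apply, mul_one]
  have key : (fun (s : S) q => (b s * of ℤ _ (incl S k s)).coeff q) = 0 := by
    refine eq_zero_of_supports_overlap hk ?_ (fun s q => ?_) fun q s hs => ?_
    · refine (Set.finite_iUnion fun s : S =>
        (b s * of ℤ _ (incl S k s)).coeff.support.finite_toSet).subset fun q ⟨s, hs⟩ => ?_
      exact Set.mem_iUnion.2 ⟨s, Finsupp.mem_support_iff.2 hs⟩
    · rw [coeff_mul_of, coeff_mul_of]
      conv_lhs => rw [← hb s, coeff_mul_of]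
      congr 1
      group
    · by_contra! hne
      apply hs
      rw [← Finset.sum_eq_single (s := Finset.univ) s
        (f := fun s : S => (b s * of ℤ _ (incl S k s)).coeff q)
        (fun s' _ h' => hne s' h') (by simp)]
      simpa [coeff_sum] using DFunLike.congr_fun (congrArg MonoidAlgebra.coeff h) q
  ext s q
  have := congrFun (congrFun key s) (q * incl S k s)
  simpa [coeff_mul_of] using this

end ConeGroup

/-! ### Elements of finite order and group rings -/

open Classical in
theorem exists_sum_pow_mul_eq_one {Γ : Type*} [Group Γ] {γ : Γ} (hγ : IsOfFinOrder γ) :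
    ∃ u : Γ → ℤ, ∀ x, ∑ i ∈ Finset.range (orderOf γ), u (γ ^ i * x) = 1 := by
  obtain ⟨T, hT, -⟩ := (Subgroup.zpowers γ).exists_isComplement_right 1
  refine ⟨fun x => if x ∈ T then 1 else 0, fun x => ?_⟩
  obtain ⟨⟨h, t⟩, rfl⟩ := hT.surjective x
  obtain ⟨j, hj, hjh⟩ := hγ.mem_zpowers_iff_mem_range_orderOf.1 (h⁻¹).2 |> Finset.mem_image.1
  rw [Finset.sum_congr rfl (g := fun i => if j = i then 1 else 0) fun i hi => ?_,
    Finset.sum_ite_eq, if_pos hj]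
  refine if_congr ?_ rfl rfl
  rw [Finset.mem_range] at hi hj
  constructor
  · intro hi'
    have e := Function.Bijective.injective hT
      (a₁ := (⟨γ ^ i * h, mul_mem (pow_mem (Subgroup.mem_zpowers γ) i) h.2⟩, t))
      (a₂ := (1, ⟨_, hi'⟩)) (by simp [mul_assoc])
    have e₁ : γ ^ i * h = 1 := congrArg (fun p => (p.1 : Γ)) e
    refine pow_injOn_Iio_orderOf hj hi ?_
    change γ ^ j = γ ^ i
    rw [hjh, eq_inv_of_mul_eq_one_left e₁, Subgroup.coe_inv]
  · rintro rfl
    rw [hjh]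
    simp

theorem sum_range_mul_of_periodic {A : Type*} [AddCommMonoid A] {f : ℕ → A} {M : ℕ}
    (hf : ∀ i, f (M + i) = f i) (c : ℕ) :
    ∑ i ∈ Finset.range (M * c), f i = c • ∑ i ∈ Finset.range M, f i := by
  have hf' (c i : ℕ) : f (M * c + i) = f i := by
    induction c with
    | zero => simp
    | succ c ih => rw [mul_add_one, add_comm (M * c), add_assoc, hf, ih]
  induction c with
  | zero => simp
  | succ c ih => simp [mul_add_one, Finset.sum_range_add, ih, hf', succ_nsmul]

namespace MonoidAlgebra

variable {Q : Type*}

/-- Multiplication of the coefficients by a weight function. -/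
noncomputable def weight (u : Q → ℤ) : MonoidAlgebra ℤ Q →+ MonoidAlgebra ℤ Q :=
  (Finsupp.liftAddHom fun q => (singleAddHom q).comp (AddMonoidHom.mulLeft (u q))).comp
    coeffAddEquiv.toAddMonoidHom

theorem weight_single (u : Q → ℤ) (q : Q) (a : ℤ) : weight u (single q a) = single q (u q * a) := by
  exact (Finsupp.sum_single_index (by simp)).trans rfl

variable [Group Q]

/-- If `g` has finite order and `π` is a homomorphism, averaging over the powers of a suitable
additive operator, which is right linear over the kernel of `π`, multiplies by the quotient of the
orders of `g` and `π g`. -/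
theorem exists_averaging {Γ : Type*} [Group Γ] (π : Q →* Γ) {g : Q} (hg : IsOfFinOrder g) :
    ∃ P : MonoidAlgebra ℤ Q →+ MonoidAlgebra ℤ Q,
      (∀ x, ∑ i ∈ Finset.range (orderOf g), of ℤ Q (g ^ i) * P (of ℤ Q (g ^ i)⁻¹ * x) =
        ((orderOf g / orderOf (π g) : ℕ) : MonoidAlgebra ℤ Q) * x) ∧
      ∀ h, π h = 1 → ∀ x, P (x * of ℤ Q h) = P x * of ℤ Q h := by
  obtain ⟨u, hu⟩ := exists_sum_pow_mul_eq_one (π.isOfFinOrder hg).inv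
  rw [orderOf_inv] at hu
  refine ⟨weight fun q => u (π q), fun x => ?_, fun h hh x => ?_⟩
  · have key (y : Γ) : ∑ i ∈ Finset.range (orderOf g), u ((π g)⁻¹ ^ i * y)
        = (orderOf g / orderOf (π g) : ℕ) := by
      conv_lhs => rw [← Nat.mul_div_cancel' (orderOf_map_dvd π g)]
      rw [sum_range_mul_of_periodic, hu, nsmul_one]
      intro i
      rw [pow_add, inv_pow _ (orderOf (π g)), pow_orderOf_eq_one, inv_one, one_mul]
    induction x using induction_linear with
    | zero => simp
    | add x y hx hy => simp only [mul_add, map_add, Finset.sum_add_distrib, hx, hy]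
    | single q a =>
      have (i : ℕ) : of ℤ Q (g ^ i) * weight (fun q => u (π q)) (of ℤ Q (g ^ i)⁻¹ * single q a)
          = singleAddHom q (u ((π g)⁻¹ ^ i * π q) * a) := by
        simp [single_mul_single, weight_single, singleAddHom]
      rw [Finset.sum_congr rfl fun i _ => this i, ← map_sum, ← Finset.sum_mul, key]
      simp [singleAddHom, natCast_def, single_mul_single]
  · induction x using induction_linear with
    | zero => simp
    | add x y hx hy => simp only [add_mul, map_add, hx, hy]
    | single q a => simp [single_mul_single, weight_single, hh]

theorem exists_eq_sum_pow_mul {g : Q} (hg : IsOfFinOrder g) {x : MonoidAlgebra ℤ Q}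
    (h : (of ℤ Q g - 1) * x = 0) :
    ∃ y, x = (∑ i ∈ Finset.range (orderOf g), of ℤ Q g ^ i) * y := by
  obtain ⟨P, hP, -⟩ := exists_averaging (MonoidHom.id Q) hg
  refine ⟨P x, ?_⟩
  have hx : of ℤ Q g * x = x := by rwa [sub_mul, one_mul, sub_eq_zero] at h
  have hi (i : ℕ) : of ℤ Q (g ^ i)⁻¹ * x = x := by
    induction i with
    | zero => simp [-of_apply]
    | succ i ih =>
      conv_lhs => rw [← hx, ← mul_assoc, ← map_mul, pow_succ', mul_inv_rev, inv_mul_cancel_right]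
      exact ih
  have := hP x
  simp only [hi] at this
  rw [MonoidHom.id_apply, Nat.div_self hg.orderOf_pos, Nat.cast_one, one_mul] at this
  simp only [← map_pow, Finset.sum_mul, this]

theorem exists_eq_sub_one_mul {g : Q} (hg : IsOfFinOrder g) {x : MonoidAlgebra ℤ Q}
    (h : (∑ i ∈ Finset.range (orderOf g), of ℤ Q g ^ i) * x = 0) :
    ∃ y, x = (of ℤ Q g - 1) * y := by
  obtain ⟨P, hP, -⟩ := exists_averaging (MonoidHom.id Q) hg
  have h₀ : ∑ i ∈ Finset.range (orderOf g), of ℤ Q (g ^ i)⁻¹ * x = 0 := by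
    rw [← Finset.sum_range_reflect]
    rw [← mul_zero (of ℤ Q (g ^ (orderOf g - 1))⁻¹), ← h, ← mul_assoc, Finset.mul_sum,
      Finset.sum_mul]
    refine Finset.sum_congr rfl fun i hi => ?_
    rw [Finset.mem_range] at hi
    rw [← map_pow, ← map_mul, pow_sub _ (show i ≤ orderOf g - 1 by omega), mul_inv_rev, inv_inv,
      (Commute.pow_pow_self g _ _).inv_right.eq]
  refine ⟨∑ i ∈ Finset.range (orderOf g),
    (∑ j ∈ Finset.range i, of ℤ Q g ^ j) * P (of ℤ Q (g ^ i)⁻¹ * x), ?_⟩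
  have := hP x
  rw [MonoidHom.id_apply, Nat.div_self hg.orderOf_pos, Nat.cast_one, one_mul] at this
  conv_lhs => rw [← this]
  rw [← sub_eq_zero, Finset.mul_sum, ← Finset.sum_sub_distrib, ← map_zero P, ← h₀, map_sum]
  refine Finset.sum_congr rfl fun i _ => ?_
  rw [← mul_assoc, mul_geom_sum, map_pow, sub_mul, one_mul, sub_sub_cancel]

theorem geom_sum_mul_of_sub_one {q : Q} {n : ℕ} (hq : q ^ n = 1) :
    (∑ i ∈ Finset.range n, of ℤ Q q ^ i) * (of ℤ Q q - 1) = 0 := by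
  rw [geom_sum_mul, ← map_pow, hq, map_one, sub_self]

end MonoidAlgebra

/-! ### Fox calculus -/

namespace PresentedGroup

open MonoidAlgebra

variable {β : Type*} (rels : Set (FreeGroup β))

section Affine

variable {M : Type*} [AddCommGroup M] [Module (MonoidAlgebra ℤ (PresentedGroup rels)) M]

/-- The action of the free group by affine maps, the generator `b` acting by translation by `v b`
after its linear action. -/
noncomputable def affineHom (v : β → M) : FreeGroup β →* Equiv.Perm M :=
  FreeGroup.lift fun b =>
    { toFun := fun y => MonoidAlgebra.of ℤ _ (of (rels := rels) b) • y + v b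
      invFun := fun y => MonoidAlgebra.of ℤ _ (of (rels := rels) b)⁻¹ • (y - v b)
      left_inv := fun y => by
        simp only
        rw [add_sub_cancel_right, ← mul_smul, ← map_mul, inv_mul_cancel, map_one, one_smul]
      right_inv := fun y => by
        simp only
        rw [← mul_smul, ← map_mul, mul_inv_cancel, map_one, one_smul, sub_add_cancel] }

theorem affineHom_of (v : β → M) (b : β) (y : M) :
    affineHom rels v (FreeGroup.of b) y = MonoidAlgebra.of ℤ _ (of (rels := rels) b) • y + v b := by
  simp [affineHom]

theorem affineHom_sub (v : β → M) (w : FreeGroup β) (y z : M) :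
    affineHom rels v w y - affineHom rels v w z = MonoidAlgebra.of ℤ _ (mk rels w) • (y - z) := by
  induction w using FreeGroup.induction_on generalizing y z with
  | C1 => simp [-MonoidAlgebra.of_apply]
  | of b =>
    rw [affineHom_of, affineHom_of, add_sub_add_right_eq_sub, smul_sub]
    rfl
  | inv_of b h =>
    have := h ((affineHom rels v (FreeGroup.of b))⁻¹ y) ((affineHom rels v (FreeGroup.of b))⁻¹ z)
    have e (z : M) :
        affineHom rels v (FreeGroup.of b) ((affineHom rels v (FreeGroup.of b))⁻¹ z) = z :=
      Equiv.apply_symm_apply _ z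
    rw [e, e] at this
    rw [this, map_inv, map_inv, ← mul_smul, ← map_mul, inv_mul_cancel, map_one, one_smul]
  | mul a b ha hb => rw [map_mul, Equiv.Perm.mul_apply, Equiv.Perm.mul_apply, ha, hb, ← mul_smul,
      ← map_mul, ← map_mul]

theorem affineHom_apply (v : β → M) (w : FreeGroup β) (y : M) :
    affineHom rels v w y = MonoidAlgebra.of ℤ _ (mk rels w) • y + affineHom rels v w 0 := by
  rw [← sub_eq_iff_eq_add, affineHom_sub, sub_zero]

theorem map_affineHom {M' : Type*} [AddCommGroup M']
    [Module (MonoidAlgebra ℤ (PresentedGroup rels)) M']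
    (L : M →ₗ[MonoidAlgebra ℤ (PresentedGroup rels)] M') (v : β → M) (w : FreeGroup β) (y : M) :
    L (affineHom rels v w y) = affineHom rels (L ∘ v) w (L y) := by
  induction w using FreeGroup.induction_on generalizing y with
  | C1 => simp
  | of b => simp only [affineHom_of, map_add, map_smul, Function.comp]
  | inv_of b h =>
    rw [map_inv, map_inv, Equiv.Perm.eq_inv_iff_eq, ← h]
    exact congrArg L (Equiv.apply_symm_apply _ y)
  | mul a b ha hb => simp only [map_mul, Equiv.Perm.mul_apply, ha, hb]

end Affine

variable [DecidableEq β]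

/-- The vector of Fox derivatives. -/
noncomputable def fox (w : FreeGroup β) : β → MonoidAlgebra ℤ (PresentedGroup rels) :=
  affineHom rels (fun b => Pi.single b 1) w 0

theorem fox_of (b : β) : fox rels (FreeGroup.of b) = Pi.single b 1 := by
  rw [fox, affineHom_of, smul_zero, zero_add]

theorem fox_mul (a b : FreeGroup β) :
    fox rels (a * b) = MonoidAlgebra.of ℤ _ (mk rels a) • fox rels b + fox rels a := by
  rw [fox, map_mul, Equiv.Perm.mul_apply, affineHom_apply, fox, fox]

theorem fox_pow (w : FreeGroup β) (k : ℕ) :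
    fox rels (w ^ k) =
      (∑ i ∈ Finset.range k, MonoidAlgebra.of ℤ _ (mk rels w) ^ i) • fox rels w := by
  induction k with
  | zero => simp [fox]
  | succ k ih =>
    rw [pow_succ, fox_mul, ih, Finset.sum_range_succ, add_smul, add_comm, map_pow, map_pow]

variable [Fintype β]

/-- The boundary map of the Cayley complex from edges to vertices. -/
noncomputable def boundary : (β → MonoidAlgebra ℤ (PresentedGroup rels)) →ₗ[MonoidAlgebra ℤ
    (PresentedGroup rels)] MonoidAlgebra ℤ (PresentedGroup rels) :=
  Fintype.linearCombination _ fun b => MonoidAlgebra.of ℤ _ (of b) - 1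

theorem boundary_fox (w : FreeGroup β) :
    boundary rels (fox rels w) = MonoidAlgebra.of ℤ _ (mk rels w) - 1 := by
  rw [fox, map_affineHom, map_zero, eq_sub_iff_add_eq]
  suffices h : ∀ y, affineHom rels (boundary rels ∘ fun b => Pi.single b 1) w y
      = MonoidAlgebra.of ℤ _ (mk rels w) * (y + 1) - 1 by rw [h, zero_add, mul_one, sub_add_cancel]
  induction w using FreeGroup.induction_on with
  | C1 => intro y; simp [-MonoidAlgebra.of_apply]
  | of b =>
    intro y
    rw [affineHom_of, Function.comp, boundary, Fintype.linearCombination_apply_single, one_smul,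
      smul_eq_mul, mul_add, mul_one, add_sub_assoc]
    rfl
  | inv_of b h =>
    intro y
    rw [map_inv, Equiv.Perm.inv_eq_iff_eq, h, sub_add_cancel, ← mul_assoc, ← map_mul, ← map_mul,
      mul_inv_cancel, map_one, map_one, one_mul, add_sub_cancel_right]
  | mul a b ha hb =>
    intro y
    rw [map_mul, Equiv.Perm.mul_apply, ha, hb, sub_add_cancel, ← mul_assoc, ← map_mul, ← map_mul]

/-- Exactness of the Fox complex of a presentation at the module of generators. -/
theorem mem_span_fox_of_boundary_eq_zero
    {c : β → MonoidAlgebra ℤ (PresentedGroup rels)} (hc : boundary rels c = 0) :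
    c ∈ Submodule.span (MonoidAlgebra ℤ (PresentedGroup rels)) (fox rels '' rels) := by
  set B := Submodule.span (MonoidAlgebra ℤ (PresentedGroup rels)) (fox rels '' rels)
  let v : β → _ := B.mkQ ∘ fun b => Pi.single b 1
  have hv (r : FreeGroup β) : affineHom rels v r 0 = B.mkQ (fox rels r) := by
    rw [fox, map_affineHom, B.mkQ.map_zero]
  have hr (r) (h : r ∈ rels) : affineHom rels v r = 1 := by
    ext1 y
    rw [affineHom_apply, hv, one_of_mem h, map_one, one_smul, Submodule.mkQ_apply,
      (Submodule.Quotient.mk_eq_zero B).2 (Submodule.subset_span ⟨r, h, rfl⟩), add_zero]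
    rfl
  let Ψ : PresentedGroup rels →* Equiv.Perm _ := QuotientGroup.lift _ (affineHom rels v)
    fun x hx => Subgroup.normalClosure_le_normal (N := (affineHom rels v).ker) hr hx
  have hΨ (w) : Ψ (mk rels w) = affineHom rels v w := rfl
  let Δ : MonoidAlgebra ℤ (PresentedGroup rels) →+ _ :=
    (Finsupp.liftAddHom fun q => (zmultiplesHom _ (Ψ q 0))).comp coeffAddEquiv.toAddMonoidHom
  have hΔ (q : PresentedGroup rels) (a : ℤ) : Δ (single q a) = a • Ψ q 0 :=
    Finsupp.sum_single_index (by simp)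
  have hΔv (b : β) (x) : Δ (x * (MonoidAlgebra.of ℤ _ (of b) - 1)) = x • v b := by
    induction x using induction_linear with
    | zero => simp
    | add x y hx hy => rw [add_mul, map_add, hx, hy, add_smul]
    | single q a =>
      obtain ⟨w, rfl⟩ := mk_surjective _ q
      have e : (single (mk rels w) a : MonoidAlgebra ℤ (PresentedGroup rels))
          = a • MonoidAlgebra.of ℤ _ (mk rels w) := by simp
      have e' : (of b : PresentedGroup rels) = mk rels (FreeGroup.of b) := rfl
      rw [mul_sub, mul_one, map_sub, MonoidAlgebra.of_apply, single_mul_single, mul_one, hΔ, hΔ,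
        e', ← map_mul, hΨ, hΨ, map_mul, Equiv.Perm.mul_apply, affineHom_apply _ _ w,
        affineHom_of, smul_zero, zero_add, ← smul_sub, add_sub_cancel_right, e, smul_assoc]
  have : Δ (boundary rels c) = B.mkQ c := by
    rw [boundary, Fintype.linearCombination_apply, map_sum]
    simp only [smul_eq_mul, hΔv]
    conv_rhs => rw [pi_eq_sum_univ' c, map_sum]
    simp only [v, Function.comp]
    refine Finset.sum_congr rfl fun b _ => ?_
    rw [map_smul]
  rw [hc, map_zero] at this
  exact (Submodule.Quotient.mk_eq_zero B).1 this.symm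

end PresentedGroup

namespace ConeGroup

open MonoidAlgebra

variable {α : Type u} {S : Set (FreeGroup α)} {k : ℕ}

theorem fox_incl_apply_inr [DecidableEq α] (x : FreeGroup α) :
    PresentedGroup.fox (coneRels S k) (FreeGroup.map Sum.inl x) (Sum.inr ()) = 0 := by
  let L : (α ⊕ Unit → MonoidAlgebra ℤ (ConeGroup S k)) →ₗ[MonoidAlgebra ℤ (ConeGroup S k)] _ :=
    LinearMap.proj (Sum.inr ())
  change L (PresentedGroup.fox (coneRels S k) (FreeGroup.map Sum.inl x)) = 0
  rw [PresentedGroup.fox, PresentedGroup.map_affineHom, map_zero]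
  induction x using FreeGroup.induction_on with
  | C1 => simp
  | of a => rw [FreeGroup.map.of, PresentedGroup.affineHom_of, smul_zero, zero_add]; simp [L]
  | inv_of a h => rw [map_inv, map_inv, Equiv.Perm.inv_eq_iff_eq, h]
  | mul a b ha hb => rw [map_mul, map_mul, Equiv.Perm.mul_apply, hb, ha]

/-- A homomorphism killing the new generator and the elements of `S` kills all elements of finite
order. -/
theorem map_eq_one_of_isOfFinOrder [Fintype α] [Fintype S] (hk : 4 ≤ k) {P : Type*} [Group P]
    (π : ConeGroup S k →* P) (hπ : π (apex S k) = 1) (hπS : ∀ s ∈ S, π (incl S k s) = 1)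
    {g : ConeGroup S k} (hg : IsOfFinOrder g) : π g = 1 := by
  classical
  obtain ⟨w, hw⟩ := PresentedGroup.mk_surjective _ g
  let N := orderOf g
  let N' := N / orderOf (π g)
  let c := PresentedGroup.fox (coneRels S k) w
  let bd := PresentedGroup.boundary (coneRels S k)
  have hc : bd c = of ℤ _ g - 1 := by rw [PresentedGroup.boundary_fox, hw]
  let ν := ∑ i ∈ Finset.range N, of ℤ _ g ^ i
  have hνT : ν * (of ℤ _ g - 1) = 0 := geom_sum_mul_of_sub_one (pow_orderOf_eq_one g)
  have hTν : (of ℤ _ g - 1) * ν = 0 := by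
    rw [mul_geom_sum, ← map_pow, pow_orderOf_eq_one, map_one, sub_self]
  let q (s : S) := incl S k s * apex S k
  let μ (s : S) := ∑ i ∈ Finset.range k, of ℤ _ (q s) ^ i
  have hμ (s : S) : μ s * (of ℤ _ (q s) - 1) = 0 := geom_sum_mul_of_sub_one (incl_mul_apex_pow s)
  let d (s : S) := PresentedGroup.fox (coneRels S k)
    (FreeGroup.map Sum.inl s.1 * FreeGroup.of (Sum.inr ()))
  have hd (s : S) : bd (d s) = of ℤ _ (q s) - 1 := PresentedGroup.boundary_fox _ _
  have hdt (s : S) : d s (Sum.inr ()) = of ℤ _ (incl S k s) := by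
    simp only [d, PresentedGroup.fox_mul, PresentedGroup.fox_of, Pi.add_apply, fox_incl_apply_inr,
      Pi.smul_apply, Pi.single_eq_same, smul_eq_mul, mul_one, add_zero]
    rfl
  obtain ⟨a, ha⟩ : ∃ a : S → MonoidAlgebra ℤ (ConeGroup S k),
      ∑ s, (a s * μ s) • d s = ν • c := by
    have hmem : ν • c ∈ Submodule.span (MonoidAlgebra ℤ (ConeGroup S k))
        (Set.range fun s : S => μ s • d s) := by
      have := PresentedGroup.mem_span_fox_of_boundary_eq_zero (coneRels S k) (c := ν • c)
        (by rw [map_smul]; exact (congrArg (ν * ·) hc).trans hνT)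
      have e : PresentedGroup.fox (coneRels S k) '' coneRels S k
          = Set.range fun s : S => μ s • d s :=
        ((Set.image_image _ _ _).trans (Set.image_eq_range _ _)).trans
          (congrArg Set.range (funext fun s => PresentedGroup.fox_pow _ _ _))
      rwa [e] at this
    obtain ⟨a, ha⟩ := (Submodule.mem_span_range_iff_exists_fun _).1 hmem
    exact ⟨a, by simpa only [mul_smul] using ha⟩
  have hb (s : S) : of ℤ _ g * (a s * μ s) = a s * μ s := by
    refine sub_eq_zero.1 ?_
    rw [← sub_one_mul]
    refine congrFun (eq_zero_of_sum_mul_incl_eq_zero hk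
      (b := fun s => (of ℤ _ g - 1) * (a s * μ s)) (fun s => ?_) ?_) s
    · rw [← sub_eq_zero, ← mul_sub_one, mul_assoc, mul_assoc, hμ, mul_zero, mul_zero]
    · have := congrFun (congrArg ((of ℤ _ g - 1) • ·) ha) (Sum.inr ())
      simp only [Finset.sum_apply, Pi.smul_apply, hdt, smul_eq_mul] at this
      rw [← mul_assoc, hTν, zero_mul, Finset.mul_sum] at this
      simpa only [mul_assoc] using this
  obtain ⟨A, hA, hA'⟩ := exists_averaging π hg
  have hAμ (s : S) (x) : A (x * μ s) = A x * μ s := by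
    simp only [μ, Finset.mul_sum, map_sum, ← map_pow]
    refine Finset.sum_congr rfl fun i _ => hA' _ ?_ _
    simp [q, hπ, hπS s s.2]
  have hAb (s : S) : (N' : MonoidAlgebra ℤ (ConeGroup S k)) * (a s * μ s)
      = ν * (A (a s) * μ s) := by
    have hi (i : ℕ) : of ℤ _ (g ^ i)⁻¹ * (a s * μ s) = a s * μ s := by
      induction i with
      | zero => simp [-of_apply]
      | succ i ih =>
        conv_lhs => rw [← hb, ← mul_assoc, ← map_mul, pow_succ', mul_inv_rev, inv_mul_cancel_right]
        exact ih
    rw [← hA, ← hAμ]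
    simp only [hi, ν, Finset.sum_mul, map_pow, N]
  let D := ∑ s, (A (a s) * μ s) • d s
  have hD : bd D = 0 := by
    rw [map_sum]
    refine Finset.sum_eq_zero fun s _ => ?_
    rw [map_smul, hd, smul_eq_mul, mul_assoc, hμ, mul_zero]
  have hνD : ν • ((N' : MonoidAlgebra ℤ (ConeGroup S k)) • c - D) = 0 := by
    rw [smul_sub, smul_smul, ← Nat.cast_comm, ← smul_smul, ← ha, sub_eq_zero, Finset.smul_sum,
      Finset.smul_sum]
    exact Finset.sum_congr rfl fun s _ => by rw [smul_smul, smul_smul, hAb]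
  choose e he using fun b => exists_eq_sub_one_mul hg (congrFun hνD b)
  have hbd : (of ℤ _ g - 1) * ((N' : MonoidAlgebra ℤ (ConeGroup S k)) - bd e) = 0 := by
    have : (N' : MonoidAlgebra ℤ (ConeGroup S k)) • c - D = (of ℤ _ g - 1) • e := funext he
    have := congrArg bd this
    rw [map_sub, map_smul, map_smul, hc, hD, sub_zero, smul_eq_mul, smul_eq_mul] at this
    rw [mul_sub, ← this, Nat.cast_comm, sub_self]
  obtain ⟨f, hf⟩ := exists_eq_sum_pow_mul hg hbd
  let ε : MonoidAlgebra ℤ (ConeGroup S k) →ₐ[ℤ] ℤ := MonoidAlgebra.lift ℤ ℤ (ConeGroup S k) 1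
  have hε (x) : ε (of ℤ _ x) = 1 := by simp [ε]
  have hεe : ε (bd e) = 0 := by
    simp only [bd, PresentedGroup.boundary, Fintype.linearCombination_apply, map_sum, smul_eq_mul,
      map_mul, map_sub, hε, map_one, sub_self, mul_zero, Finset.sum_const_zero]
  have hN := congrArg ε hf
  simp only [map_sub, map_natCast, hεe, sub_zero, map_mul, map_sum, map_pow, hε, one_pow,
    Finset.sum_const, Finset.card_range, nsmul_eq_mul, mul_one] at hN
  have hdvd : N ∣ N' := Int.natCast_dvd_natCast.1 ⟨_, hN⟩
  have hpos : 0 < N := hg.orderOf_pos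
  have hM : orderOf (π g) ∣ N := orderOf_map_dvd π g
  have hMpos := Nat.pos_of_dvd_of_pos hM hpos
  have hN'pos : 0 < N' := Nat.div_pos (Nat.le_of_dvd hpos hM) hMpos
  rw [← orderOf_eq_one_iff]
  by_contra hne
  exact (Nat.div_lt_self hpos (by omega)).not_ge (Nat.le_of_dvd hN'pos hdvd)

end ConeGroup

theorem PtkRels_eq_coneRels {m n k : ℕ} (r : Fin n → Word (Fin m)) :
    PtkRels m n k r = coneRels (Set.range (fun i => FreeGroup.mk (r i)) ∪ {1}) k := by
  rw [coneRels, Set.image_union, ← Set.range_comp, Set.image_singleton, map_one, one_mul]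
  rfl

theorem torOne_le_ker_of_eq_coneRels {α : Type u} [Fintype α] {S : Set (FreeGroup α)}
    (hS : S.Finite) {k : ℕ} (hk : 4 ≤ k) {rels : Set (FreeGroup (α ⊕ Unit))}
    (hrels : rels = coneRels S k) {P : Type*} [Group P] (π : PresentedGroup rels →* P)
    (hπ : π (PresentedGroup.of (Sum.inr ())) = 1)
    (hπS : ∀ s ∈ S, π (PresentedGroup.mk rels (FreeGroup.map Sum.inl s)) = 1) :
    torOne (PresentedGroup rels) ≤ π.ker := by
  subst hrels
  have := hS.fintype
  exact Subgroup.normalClosure_le_normal fun g hg =>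
    ConeGroup.map_eq_one_of_isOfFinOrder hk π hπ hπS hg

/-- Theorem: for `P = ⟨x₁,…,x_m | r₁,…,rₙ⟩` with all relators freely reduced, cyclically
reduced and distinct, and `k ≥ 12`, the homomorphism `π` from the group presented by
`P_t^k = ⟨x₁,…,x_m,t | (r₁t)^k,…,(rₙt)^k, t^k⟩` to the group presented by `P`, induced by
`xᵢ ↦ xᵢ` and `t ↦ 1`, is well defined and surjective with kernel `tor₁`; consequently it
induces an isomorphism `P̄_t^k / tor₁(P̄_t^k) ≅ P̄`. -/
theorem ptk_quotient_tor_one {m n k : ℕ} (hk : 12 ≤ k) (r : Fin n → Word (Fin m))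
    (hred : ∀ i, Reduced (r i)) (hcyc : ∀ i, CyclicallyReduced (r i))
    (hdist : Function.Injective r) :
    ∃ π : PresentedGroup (PtkRels m n k r) →* PresentedGroup (PRels m n r),
      (∀ i : Fin m, π (PresentedGroup.of (Sum.inl i)) = PresentedGroup.of i) ∧
      π (PresentedGroup.of (Sum.inr ())) = 1 ∧
      Function.Surjective π ∧
      π.ker = torOne (PresentedGroup (PtkRels m n k r)) ∧
      ∃ e : (PresentedGroup (PtkRels m n k r) ⧸ torOne (PresentedGroup (PtkRels m n k r)))
          ≃* PresentedGroup (PRels m n r),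
        ∀ x : PresentedGroup (PtkRels m n k r), e (QuotientGroup.mk x) = π x := by
  let Q := PresentedGroup (PtkRels m n k r)
  let P := PresentedGroup (PRels m n r)
  let f : FreeGroup (Fin m ⊕ Unit) →* P :=
    FreeGroup.lift (Sum.elim PresentedGroup.of fun _ => 1)
  have hf (w : FreeGroup (Fin m)) : f (FreeGroup.map Sum.inl w) = PresentedGroup.mk _ w :=
    DFunLike.congr_fun (show f.comp (FreeGroup.map Sum.inl) = PresentedGroup.mk _ from
      FreeGroup.ext_hom _ _ fun a => by simp [f]; rfl) w
  have hft : f (tGen m) = 1 := by simp [f, tGen]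
  have hr (i : Fin n) : (PresentedGroup.mk _ (FreeGroup.mk (r i)) : P) = 1 :=
    PresentedGroup.one_of_mem ⟨i, rfl⟩
  have hfr (i : Fin n) : f (rho r i) = 1 := (hf (FreeGroup.mk (r i))).trans (hr i)
  let π : Q →* P := PresentedGroup.toGroup (f := Sum.elim PresentedGroup.of fun _ => 1) <| by
    change ∀ x ∈ PtkRels m n k r, f x = 1
    rintro _ (⟨i, rfl⟩ | rfl)
    · simp only [map_pow, map_mul, hfr, hft, one_mul, one_pow]
    · rw [map_pow, hft, one_pow]
  have hπ (w) : π (PresentedGroup.mk _ w) = f w := rfl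
  have hπx (i : Fin m) : π (PresentedGroup.of (Sum.inl i)) = PresentedGroup.of i :=
    PresentedGroup.toGroup.of _
  have hπt : π (PresentedGroup.of (Sum.inr ())) = 1 := PresentedGroup.toGroup.of _
  have hsurj : Function.Surjective π := fun y => by
    obtain ⟨w, rfl⟩ := PresentedGroup.mk_surjective _ y
    exact ⟨PresentedGroup.mk _ (FreeGroup.map Sum.inl w), hf w⟩
  have hle : torOne Q ≤ π.ker := by
    refine torOne_le_ker_of_eq_coneRels ((Set.finite_range _).union (Set.finite_singleton _))
      (by omega) (PtkRels_eq_coneRels r) π hπt ?_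
    rintro _ (⟨i, rfl⟩ | rfl)
    · exact hfr i
    · simp
  have hk₀ : 0 < k := by omega
  let p : Q →* Q ⧸ torOne Q := QuotientGroup.mk' _
  have hp {g : Q} (hg : g ^ k = 1) : p g = 1 := (QuotientGroup.eq_one_iff g).2 <|
    Subgroup.subset_normalClosure (isOfFinOrder_iff_pow_eq_one.2 ⟨k, hk₀, hg⟩)
  have hpt : p (PresentedGroup.mk _ (tGen m)) = 1 := hp <|
    PresentedGroup.one_of_mem (rels := PtkRels m n k r) (Or.inr rfl)
  have hpr (i : Fin n) : p (PresentedGroup.mk _ (rho r i)) = 1 := by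
    have := hp (g := PresentedGroup.mk _ (rho r i * tGen m)) <|
      PresentedGroup.one_of_mem (rels := PtkRels m n k r) (Or.inl ⟨i, rfl⟩)
    rwa [map_mul, map_mul, hpt, mul_one] at this
  let θ : FreeGroup (Fin m) →* Q ⧸ torOne Q :=
    (p.comp (PresentedGroup.mk _)).comp (FreeGroup.map Sum.inl)
  let σ : P →* Q ⧸ torOne Q := QuotientGroup.lift _ θ fun x hx =>
    Subgroup.normalClosure_le_normal (N := θ.ker) (by rintro _ ⟨i, rfl⟩; exact hpr i) hx
  have hσ : σ.comp π = p := PresentedGroup.ext fun x => by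
    rcases x with i | ⟨⟩
    · rw [MonoidHom.comp_apply, hπx]
      rfl
    · rw [MonoidHom.comp_apply, hπt, map_one]
      exact hpt.symm
  have hker : π.ker = torOne Q := by
    refine le_antisymm (fun g hg => ?_) hle
    rw [← QuotientGroup.eq_one_iff, ← QuotientGroup.mk'_apply]
    change p g = 1
    rw [← hσ, MonoidHom.comp_apply, hg, map_one]
  exact ⟨π, hπx, hπt, hsurj, hker, (QuotientGroup.quotientMulEquivOfEq hker.symm).trans
    (QuotientGroup.quotientKerEquivOfSurjective π hsurj), fun x => rfl⟩
end
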